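/- arXiv:0811.1667 — 2 statements merged into one kernel-verified Lean document; each statement's English description precedes it below -/
import Mathlib

section
/- Let σ ∈ [0,1], κ ≥ 0, l, w, m ∈ ℝ, N ∈ ℕ*, let a ∈ Π_{σ,κ}^{l,w,m}(ℝ^{3n}, M_N(ℂ)), let u ∈ S(ℝ^{2n}, M_N(ℂ)) and let β ∈ ℕ^n. Then the two iterated integrals R_{β,u}(a) := ∫_{ℝ^n}∫_{ℝ^n}( ∫_{ℝ^n} ζ^β e^{2πi⟨ϑ,ζ⟩} Tr( a(x,ζ,ϑ) u(x,ζ) ) dζ ) dϑ dx and S_{β,u}(a) := (i/2π)^{|β|} ∫_{ℝ^n}∫_{ℝ^n}( ∫_{ℝ^n} e^{2πi⟨ϑ,ζ⟩} Tr( ∂_ϑ^β a(x,ζ,ϑ) u(x,ζ) ) dζ ) dϑ dx are both well defined (the inner ζ-integral converges absolutely for each (x,ϑ), and the resulting function of (x,ϑ) is absolutely integrable over ℝ^{2n}), and R_{β,u}(a) = S_{β,u}(a). -/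
open MeasureTheory
open scoped BigOperators

noncomputable section

/-- Japanese bracket `⟨v⟩ = (1 + ‖v‖²)^(1/2)` (with the Euclidean norm). -/
def jb {n : ℕ} (v : Fin n → ℝ) : ℝ := Real.sqrt (1 + ∑ i, (v i) ^ 2)

/-- Japanese bracket of a pair of vectors, `⟨(x,y)⟩`. -/
def jb2 {n m : ℕ} (x : Fin n → ℝ) (y : Fin m → ℝ) : ℝ :=
  Real.sqrt (1 + ∑ i, (x i) ^ 2 + ∑ j, (y j) ^ 2)

/-- Euclidean inner product `⟨ϑ, ζ⟩`. -/
def ip {n : ℕ} (ϑ ζ : Fin n → ℝ) : ℝ := ∑ i, ϑ i * ζ i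

/-- Partial derivative in the `i`-th coordinate direction. -/
def pd {n : ℕ} {E : Type*} [NormedAddCommGroup E] [NormedSpace ℝ E]
    (i : Fin n) (f : (Fin n → ℝ) → E) : (Fin n → ℝ) → E :=
  fun x => fderiv ℝ f x (Pi.single i 1)

/-- Iterated partial derivative `∂^ν` along the multi-index `ν`. -/
def pdm {n : ℕ} {E : Type*} [NormedAddCommGroup E] [NormedSpace ℝ E]
    (ν : Fin n → ℕ) (f : (Fin n → ℝ) → E) : (Fin n → ℝ) → E :=
  (List.finRange n).foldr (fun i g => (pd i)^[ν i] g) f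

/-- Mixed partial derivative `∂_x^α ∂_y^β` of a function of two vector variables. -/
def pdm2 {n m : ℕ} {E : Type*} [NormedAddCommGroup E] [NormedSpace ℝ E]
    (α : Fin n → ℕ) (β : Fin m → ℕ) (f : (Fin n → ℝ) → (Fin m → ℝ) → E) :
    (Fin n → ℝ) → (Fin m → ℝ) → E :=
  fun x y => pdm α (fun x' => pdm β (f x') y) x

/-- Mixed partial derivative `∂_x^α ∂_y^β ∂_z^γ` of a function of three vector variables. -/
def pdm3 {n m k : ℕ} {E : Type*} [NormedAddCommGroup E] [NormedSpace ℝ E]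
    (α : Fin n → ℕ) (β : Fin m → ℕ) (γ : Fin k → ℕ)
    (f : (Fin n → ℝ) → (Fin m → ℝ) → (Fin k → ℝ) → E) :
    (Fin n → ℝ) → (Fin m → ℝ) → (Fin k → ℝ) → E :=
  fun x y z => pdm α (fun x' => pdm β (fun y' => pdm γ (f x' y') z) y) x

/-- Length `|ν|` of a multi-index. -/
def msize {n : ℕ} (ν : Fin n → ℕ) : ℕ := ∑ i, ν i

/-- The class `G_σ(ℝ^n, E)`: smooth functions whose `ν`-th derivative is
`O(⟨v⟩^{-σ(|ν|-1)})` for every `ν ≠ 0`. -/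
def GsigmaCl {n : ℕ} {E : Type*} [NormedAddCommGroup E] [NormedSpace ℝ E]
    (σ : ℝ) (f : (Fin n → ℝ) → E) : Prop :=
  ContDiff ℝ (⊤ : ℕ∞) f ∧ ∀ ν : Fin n → ℕ, ν ≠ 0 → ∃ C > 0, ∀ v,
    ‖pdm ν f v‖ ≤ C * jb v ^ (-(σ * ((msize ν : ℝ) - 1)))

/-- The class `S_σ(ℝ^n)`: smooth real functions whose `ν`-th derivative is
`O(⟨v⟩^{-σ|ν|})` for every `ν`. -/
def SsigmaCl {n : ℕ} (σ : ℝ) (f : (Fin n → ℝ) → ℝ) : Prop :=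
  ContDiff ℝ (⊤ : ℕ∞) f ∧ ∀ ν : Fin n → ℕ, ∃ C > 0, ∀ v,
    |pdm ν f v| ≤ C * jb v ^ (-(σ * (msize ν : ℝ)))

/-- `G_σ^×(ℝ^p)`: diffeomorphisms `g` of `ℝ^p` with `g` and `g⁻¹` in `G_σ`. -/
def GsigmaX {p : ℕ} (σ : ℝ) (g : (Fin p → ℝ) → (Fin p → ℝ)) : Prop :=
  ∃ h : (Fin p → ℝ) → (Fin p → ℝ),
    Function.LeftInverse h g ∧ Function.RightInverse h g ∧ GsigmaCl σ g ∧ GsigmaCl σ h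

/-- The class `O_M(ℝ^n, E)`: smooth functions with polynomially bounded derivatives. -/
def OMCl {n : ℕ} {E : Type*} [NormedAddCommGroup E] [NormedSpace ℝ E]
    (f : (Fin n → ℝ) → E) : Prop :=
  ContDiff ℝ (⊤ : ℕ∞) f ∧ ∀ ν : Fin n → ℕ, ∃ C > 0, ∃ k : ℕ, ∀ v,
    ‖pdm ν f v‖ ≤ C * jb v ^ (k : ℝ)

/-- `O_M^×(ℝ^p, ℝ^p)`: diffeomorphisms `g` of `ℝ^p` with `g` and `g⁻¹` in `O_M`. -/
def OMX {p : ℕ} (g : (Fin p → ℝ) → (Fin p → ℝ)) : Prop :=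
  ∃ h : (Fin p → ℝ) → (Fin p → ℝ),
    Function.LeftInverse h g ∧ Function.RightInverse h g ∧ OMCl g ∧ OMCl h

/-- The symbol space `S_σ^{l,m}(ℝ^{2n}, E)`. -/
def Ssym {n : ℕ} {E : Type*} [NormedAddCommGroup E] [NormedSpace ℝ E]
    (σ l m : ℝ) (a : (Fin n → ℝ) → (Fin n → ℝ) → E) : Prop :=
  ContDiff ℝ (⊤ : ℕ∞) (fun q : (Fin n → ℝ) × (Fin n → ℝ) => a q.1 q.2) ∧
  ∀ α β : Fin n → ℕ, ∃ C > 0, ∀ x ϑ,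
    ‖pdm2 α β a x ϑ‖ ≤ C * jb x ^ (σ * (l - (msize α : ℝ))) * jb ϑ ^ (m - (msize β : ℝ))

/-- The amplitude space `Π_{σ,κ}^{l,w,m}(ℝ^{3n}, E)`. -/
def Amp {n : ℕ} {E : Type*} [NormedAddCommGroup E] [NormedSpace ℝ E]
    (σ κ l w m : ℝ) (a : (Fin n → ℝ) → (Fin n → ℝ) → (Fin n → ℝ) → E) : Prop :=
  ContDiff ℝ (⊤ : ℕ∞)
    (fun q : ((Fin n → ℝ) × (Fin n → ℝ)) × (Fin n → ℝ) => a q.1.1 q.1.2 q.2) ∧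
  ∀ α β γ : Fin n → ℕ, ∃ C > 0, ∀ x ζ ϑ,
    ‖pdm3 α β γ a x ζ ϑ‖ ≤
      C * jb x ^ (σ * (l - ((msize α + msize β : ℕ) : ℝ))) *
        jb ζ ^ (w + κ * ((msize α + msize β : ℕ) : ℝ)) * jb ϑ ^ (m - (msize γ : ℝ))

/-- The space `H_{σ,κ}^{w}(E)` of smooth functions on `ℝ^{2n}`. -/
def Hsp {n : ℕ} {F : Type*} [NormedAddCommGroup F] [NormedSpace ℝ F]
    (σ κ w : ℝ) (g : (Fin n → ℝ) → (Fin n → ℝ) → F) : Prop :=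
  ContDiff ℝ (⊤ : ℕ∞) (fun q : (Fin n → ℝ) × (Fin n → ℝ) => g q.1 q.2) ∧
  ∀ α β : Fin n → ℕ, ¬(α = 0 ∧ β = 0) → ∃ C > 0, ∀ x ζ,
    ‖pdm2 α β g x ζ‖ ≤ C * jb x ^ (-(σ * (((msize α + msize β : ℕ) : ℝ) - 1))) *
      jb ζ ^ (w + κ * (((msize α + msize β : ℕ) : ℝ) - 1))

/-- The space `E_{σ,κ}^{w}(E)` of smooth functions on `ℝ^{2n}`. -/
def Esp {n : ℕ} {F : Type*} [NormedAddCommGroup F] [NormedSpace ℝ F]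
    (σ κ w : ℝ) (g : (Fin n → ℝ) → (Fin n → ℝ) → F) : Prop :=
  ContDiff ℝ (⊤ : ℕ∞) (fun q : (Fin n → ℝ) × (Fin n → ℝ) => g q.1 q.2) ∧
  ∀ α β : Fin n → ℕ, ∃ C > 0, ∀ x ζ,
    ‖pdm2 α β g x ζ‖ ≤ C * jb x ^ (-(σ * ((msize α + msize β : ℕ) : ℝ))) *
      jb ζ ^ (w + κ * ((msize α + msize β : ℕ) : ℝ))

/-- Jacobian determinant of a map `ℝ^p → ℝ^p`. -/
def Jdet {p : ℕ} (g : (Fin p → ℝ) → (Fin p → ℝ)) : (Fin p → ℝ) → ℝ :=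
  fun v => LinearMap.det (fderiv ℝ g v).toLinearMap

/-- The seminorm `q_{p,(α,β)}(K) = sup ⟨(x,y)⟩^p |∂^{(α,β)} K (x,y)|`. -/
def qSem {n : ℕ} (p : ℕ) (α β : Fin n → ℕ)
    (K : (Fin n → ℝ) → (Fin n → ℝ) → ℂ) : ℝ :=
  ⨆ q : (Fin n → ℝ) × (Fin n → ℝ), jb2 q.1 q.2 ^ p * ‖pdm2 α β K q.1 q.2‖

/-- Mixed partial derivative `∂_r^α ∂_θ^β` of a function of two real variables. -/
def pd2 (α β : ℕ) (F : ℝ → ℝ → ℝ) (r θ : ℝ) : ℝ :=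
  iteratedDeriv α (fun r' => iteratedDeriv β (fun θ' => F r' θ') θ) r

/-- Smooth real function on `ℝ` with all derivatives bounded. -/
def BddSmooth (a : ℝ → ℝ) : Prop :=
  ContDiff ℝ (⊤ : ℕ∞) a ∧ ∀ k : ℕ, ∃ C : ℝ, ∀ t, |iteratedDeriv k a t| ≤ C

/-- Inverse hyperbolic cosine, `arcosh x = log (x + √(x²-1))`. -/
def arcosh (x : ℝ) : ℝ := Real.log (x + Real.sqrt (x ^ 2 - 1))

attribute [local instance] Matrix.normedAddCommGroup Matrix.normedSpace

section Helpers

variable {n : ℕ} {E : Type*} [NormedAddCommGroup E] [NormedSpace ℝ E]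

lemma pd_contDiff (i : Fin n) {f : (Fin n → ℝ) → E} (hf : ContDiff ℝ (⊤ : ℕ∞) f) :
    ContDiff ℝ (⊤ : ℕ∞) (pd i f) := by
  unfold pd
  exact (hf.fderiv_right (m := (⊤ : ℕ∞)) (by simp)).clm_apply contDiff_const

lemma pd_iter_contDiff (i : Fin n) (k : ℕ) {f : (Fin n → ℝ) → E}
    (hf : ContDiff ℝ (⊤ : ℕ∞) f) : ContDiff ℝ (⊤ : ℕ∞) ((pd i)^[k] f) := by
  induction k with
  | zero => exact hf
  | succ k ih => rw [Function.iterate_succ_apply']; exact pd_contDiff i ih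

lemma pd_comm (i j : Fin n) {f : (Fin n → ℝ) → E} (hf : ContDiff ℝ (⊤ : ℕ∞) f) :
    pd i (pd j f) = pd j (pd i f) := by
  funext x
  have hd : DifferentiableAt ℝ (fderiv ℝ f) x :=
    ((hf.fderiv_right (m := (⊤ : ℕ∞)) (by simp)).differentiable (by simp)) x
  have hs : IsSymmSndFDerivAt ℝ f x :=
    hf.contDiffAt.isSymmSndFDerivAt (by
      rw [minSmoothness_of_isRCLikeNormedField]
      exact WithTop.coe_le_coe.2 (le_top (a := (2 : ℕ∞))))
  have key : ∀ a b : Fin n → ℝ,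
      fderiv ℝ (fun y => fderiv ℝ f y a) x b = fderiv ℝ (fderiv ℝ f) x b a := by
    intro a b
    rw [fderiv_clm_apply hd (differentiableAt_const a)]
    simp
  unfold pd
  rw [key, key]
  exact hs _ _

lemma pd_iter_comm (i j : Fin n) (k : ℕ) {f : (Fin n → ℝ) → E}
    (hf : ContDiff ℝ (⊤ : ℕ∞) f) : pd i ((pd j)^[k] f) = (pd j)^[k] (pd i f) := by
  induction k with
  | zero => rfl
  | succ k ih =>
    rw [Function.iterate_succ_apply', Function.iterate_succ_apply',
      pd_comm i j (pd_iter_contDiff j k hf), ih]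

lemma foldr_contDiff (l : List (Fin n)) (ν : Fin n → ℕ) {f : (Fin n → ℝ) → E}
    (hf : ContDiff ℝ (⊤ : ℕ∞) f) :
    ContDiff ℝ (⊤ : ℕ∞) (l.foldr (fun i g => (pd i)^[ν i] g) f) := by
  induction l with
  | nil => exact hf
  | cons j l ih => exact pd_iter_contDiff j _ ih

lemma foldr_congr_nu (l : List (Fin n)) (ν ν' : Fin n → ℕ) (f : (Fin n → ℝ) → E)
    (h : ∀ i ∈ l, ν i = ν' i) :
    l.foldr (fun i g => (pd i)^[ν i] g) f = l.foldr (fun i g => (pd i)^[ν' i] g) f := by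
  induction l with
  | nil => rfl
  | cons j l ih =>
    simp only [List.foldr_cons]
    rw [ih (fun i hi => h i (List.mem_cons_of_mem _ hi)), h j List.mem_cons_self]

lemma foldr_zero (l : List (Fin n)) (f : (Fin n → ℝ) → E) :
    l.foldr (fun i g => (pd i)^[(0 : Fin n → ℕ) i] g) f = f := by
  induction l with
  | nil => rfl
  | cons j l ih => simp

lemma pdm_zero (f : (Fin n → ℝ) → E) : pdm 0 f = f := foldr_zero _ f

lemma foldr_add_single (l : List (Fin n)) (hl : l.Nodup) (i : Fin n) (hi : i ∈ l)
    (ν : Fin n → ℕ) {f : (Fin n → ℝ) → E} (hf : ContDiff ℝ (⊤ : ℕ∞) f) :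
    l.foldr (fun j g => (pd j)^[(ν + Pi.single i 1 : Fin n → ℕ) j] g) f
      = pd i (l.foldr (fun j g => (pd j)^[ν j] g) f) := by
  induction l with
  | nil => simp at hi
  | cons j l ih =>
    simp only [List.foldr_cons]
    rw [List.nodup_cons] at hl
    by_cases hij : j = i
    · subst hij
      rw [foldr_congr_nu l (ν + Pi.single j 1) ν]
      · have : (ν + Pi.single j 1 : Fin n → ℕ) j = ν j + 1 := by simp
        rw [this, Function.iterate_succ_apply']
      · intro k hk
        have : k ≠ j := fun h => hl.1 (h ▸ hk)
        simp [this]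
    · have hi' : i ∈ l := by
        rcases List.mem_cons.1 hi with h | h
        · exact absurd h.symm hij
        · exact h
      have : (ν + Pi.single i 1 : Fin n → ℕ) j = ν j := by simp [hij]
      rw [ih hl.2 hi', this, pd_iter_comm i j _ (foldr_contDiff l ν hf)]

lemma pdm_add_single (i : Fin n) (ν : Fin n → ℕ) {f : (Fin n → ℝ) → E}
    (hf : ContDiff ℝ (⊤ : ℕ∞) f) : pdm (ν + Pi.single i 1) f = pd i (pdm ν f) :=
  foldr_add_single _ (List.nodup_finRange n) i (List.mem_finRange i) ν hf

lemma pdm_single (i : Fin n) (k : ℕ) {f : (Fin n → ℝ) → E}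
    (hf : ContDiff ℝ (⊤ : ℕ∞) f) : pdm (Pi.single i k) f = (pd i)^[k] f := by
  induction k with
  | zero => simp [pdm_zero]
  | succ k ih =>
    rw [Function.iterate_succ_apply', ← ih, ← pdm_add_single i _ hf, Pi.single_add]

/-- Joint smoothness in the three variables. -/
def Sm3 (A : (Fin n → ℝ) → (Fin n → ℝ) → (Fin n → ℝ) → E) : Prop :=
  ContDiff ℝ (⊤ : ℕ∞)
    (fun q : ((Fin n → ℝ) × (Fin n → ℝ)) × (Fin n → ℝ) => A q.1.1 q.1.2 q.2)

lemma Sm3.zeta {A : (Fin n → ℝ) → (Fin n → ℝ) → (Fin n → ℝ) → E} (h : Sm3 A)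
    (x ϑ : Fin n → ℝ) : ContDiff ℝ (⊤ : ℕ∞) (fun ζ => A x ζ ϑ) :=
  h.comp (f := fun ζ : Fin n → ℝ => ((x, ζ), ϑ)) (by fun_prop)

lemma Sm3.theta {A : (Fin n → ℝ) → (Fin n → ℝ) → (Fin n → ℝ) → E} (h : Sm3 A)
    (x ζ : Fin n → ℝ) : ContDiff ℝ (⊤ : ℕ∞) (fun ϑ => A x ζ ϑ) :=
  h.comp (f := fun ϑ : Fin n → ℝ => ((x, ζ), ϑ)) (by fun_prop)

lemma Sm3.pd_zeta {A : (Fin n → ℝ) → (Fin n → ℝ) → (Fin n → ℝ) → E} (h : Sm3 A)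
    (i : Fin n) : Sm3 (fun x ζ ϑ => pd i (fun ζ' => A x ζ' ϑ) ζ) := by
  unfold Sm3 pd
  refine ContDiff.clm_apply ?_ contDiff_const
  refine ContDiff.fderiv (m := (⊤ : ℕ∞)) (n := (⊤ : ℕ∞))
    (f := fun (q : ((Fin n → ℝ) × (Fin n → ℝ)) × (Fin n → ℝ)) ζ' => A q.1.1 ζ' q.2)
    (g := fun q => q.1.2) ?_ (by fun_prop) (by simp)
  exact h.comp (f := fun (q : (((Fin n → ℝ) × (Fin n → ℝ)) × (Fin n → ℝ)) × (Fin n → ℝ)) =>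
    ((q.1.1.1, q.2), q.1.2)) (by fun_prop)

lemma Sm3.pd_theta {A : (Fin n → ℝ) → (Fin n → ℝ) → (Fin n → ℝ) → E} (h : Sm3 A)
    (i : Fin n) : Sm3 (fun x ζ => pd i (A x ζ)) := by
  unfold Sm3 pd
  refine ContDiff.clm_apply ?_ contDiff_const
  refine ContDiff.fderiv (m := (⊤ : ℕ∞)) (n := (⊤ : ℕ∞))
    (f := fun (q : ((Fin n → ℝ) × (Fin n → ℝ)) × (Fin n → ℝ)) ϑ => A q.1.1 q.1.2 ϑ)
    (g := fun q => q.2) ?_ (by fun_prop) (by simp)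
  exact h.comp (f := fun (q : (((Fin n → ℝ) × (Fin n → ℝ)) × (Fin n → ℝ)) × (Fin n → ℝ)) =>
    ((q.1.1.1, q.1.1.2), q.2)) (by fun_prop)

lemma Sm3.iter_theta {A : (Fin n → ℝ) → (Fin n → ℝ) → (Fin n → ℝ) → E} (h : Sm3 A)
    (i : Fin n) (k : ℕ) : Sm3 (fun x ζ => (pd i)^[k] (A x ζ)) := by
  induction k with
  | zero => exact h
  | succ k ih => simp only [Function.iterate_succ_apply']; exact ih.pd_theta i

lemma Sm3.pdm_theta {A : (Fin n → ℝ) → (Fin n → ℝ) → (Fin n → ℝ) → E} (h : Sm3 A)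
    (γ : Fin n → ℕ) : Sm3 (fun x ζ => pdm γ (A x ζ)) := by
  unfold pdm
  generalize List.finRange n = l
  induction l with
  | nil => exact h
  | cons j l ih => simp only [List.foldr_cons]; exact ih.iter_theta j _

/-- Admissible functions: all pure `ζ_i`-derivatives have polynomial growth, with an exponent in
`ϑ` which does not depend on the order of differentiation. -/
def AdmI (i : Fin n) (M : ℕ) (A : (Fin n → ℝ) → (Fin n → ℝ) → (Fin n → ℝ) → E) : Prop :=
  Sm3 A ∧ ∀ k : ℕ, ∃ C : ℝ, ∃ L : ℕ, 0 ≤ C ∧ ∀ x ζ ϑ,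
    ‖(pd i)^[k] (fun ζ' => A x ζ' ϑ) ζ‖ ≤ C * (1 + ‖x‖) ^ L * (1 + ‖ζ‖) ^ L * (1 + ‖ϑ‖) ^ M

lemma AdmI.pd_zeta {i : Fin n} {M : ℕ} {A : (Fin n → ℝ) → (Fin n → ℝ) → (Fin n → ℝ) → E}
    (h : AdmI i M A) : AdmI i M (fun x ζ ϑ => pd i (fun ζ' => A x ζ' ϑ) ζ) := by
  refine ⟨h.1.pd_zeta i, fun k => ?_⟩
  obtain ⟨C, L, hC, hb⟩ := h.2 (k + 1)
  exact ⟨C, L, hC, fun x ζ ϑ => hb x ζ ϑ⟩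

lemma jb_ge_one (v : Fin n → ℝ) : 1 ≤ jb v := by
  unfold jb
  rw [Real.one_le_sqrt]
  have : 0 ≤ ∑ i, (v i) ^ 2 := Finset.sum_nonneg fun i _ => sq_nonneg _
  linarith

lemma jb_le (v : Fin n → ℝ) : jb v ≤ (1 + n) * (1 + ‖v‖) := by
  unfold jb
  apply Real.sqrt_le_iff.2
  refine ⟨by positivity, ?_⟩
  have h1 : ∑ i, (v i) ^ 2 ≤ ∑ _i : Fin n, ‖v‖ ^ 2 := by
    apply Finset.sum_le_sum
    intro i _
    have := norm_le_pi_norm v i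
    rw [Real.norm_eq_abs] at this
    rw [← sq_abs]
    gcongr
  simp at h1
  have h2 : (0:ℝ) ≤ n := Nat.cast_nonneg n
  have h3 := norm_nonneg v
  nlinarith [mul_nonneg h2 h3, mul_nonneg h2 (sq_nonneg ‖v‖), mul_nonneg (mul_nonneg h2 h2) (sq_nonneg ‖v‖),
    mul_nonneg (mul_nonneg h2 h2) h3]

lemma jb_rpow_le (s : ℝ) (K : ℕ) (hK : s ≤ K) (v : Fin n → ℝ) :
    jb v ^ s ≤ (1 + n : ℝ) ^ K * (1 + ‖v‖) ^ K := by
  calc jb v ^ s ≤ jb v ^ (K : ℝ) := Real.rpow_le_rpow_of_exponent_le (jb_ge_one v) hK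
    _ = jb v ^ K := Real.rpow_natCast _ _
    _ ≤ ((1 + n) * (1 + ‖v‖)) ^ K :=
      pow_le_pow_left₀ (by linarith [jb_ge_one v]) (jb_le v) K
    _ = _ := mul_pow _ _ _

/-- Polynomial growth. -/
def Slow (M : ℕ) (A : (Fin n → ℝ) → (Fin n → ℝ) → (Fin n → ℝ) → E) : Prop :=
  ∃ C : ℝ, ∃ L : ℕ, 0 ≤ C ∧ ∀ x ζ ϑ,
    ‖A x ζ ϑ‖ ≤ C * (1 + ‖x‖) ^ L * (1 + ‖ζ‖) ^ L * (1 + ‖ϑ‖) ^ M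

lemma AdmI.slow {i : Fin n} {M : ℕ} {A : (Fin n → ℝ) → (Fin n → ℝ) → (Fin n → ℝ) → E}
    (h : AdmI i M A) : Slow M A := h.2 0

lemma Amp.slow_aux {σ κ l w m : ℝ} {a : (Fin n → ℝ) → (Fin n → ℝ) → (Fin n → ℝ) → E}
    (ha : Amp σ κ l w m a) (β γ : Fin n → ℕ) :
    Slow ⌈|m|⌉₊ (fun x ζ ϑ => pdm β (fun ζ' => pdm γ (a x ζ') ϑ) ζ) := by
  obtain ⟨C, hC, hb⟩ := ha.2 0 β γ
  set s1 := σ * (l - ((msize (0 : Fin n → ℕ) + msize β : ℕ) : ℝ))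
  set s2 := w + κ * ((msize (0 : Fin n → ℕ) + msize β : ℕ) : ℝ)
  obtain ⟨L, hL⟩ : ∃ L : ℕ, s1 ≤ L ∧ s2 ≤ L := by
    obtain ⟨L, hL⟩ := exists_nat_ge (max s1 s2)
    exact ⟨L, (le_max_left _ _).trans hL, (le_max_right _ _).trans hL⟩
  have hm : m - (msize γ : ℝ) ≤ (⌈|m|⌉₊ : ℝ) := by
    have h1 := Nat.le_ceil |m|
    have h2 := le_abs_self m
    have h3 : (0:ℝ) ≤ msize γ := Nat.cast_nonneg _
    linarith
  generalize ⌈|m|⌉₊ = M at hm ⊢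
  refine ⟨C * (1 + n : ℝ) ^ L * (1 + n : ℝ) ^ L * (1 + n : ℝ) ^ M, L, by positivity,
    fun x ζ ϑ => ?_⟩
  have h0 := hb x ζ ϑ
  unfold pdm3 at h0
  rw [pdm_zero] at h0
  refine h0.trans ?_
  have p1 := jb_rpow_le s1 L hL.1 x
  have p2 := jb_rpow_le s2 L hL.2 ζ
  have p3 := jb_rpow_le _ M hm ϑ
  have q1 : 0 ≤ jb x ^ s1 := Real.rpow_nonneg (by linarith [jb_ge_one x]) _
  have q2 : 0 ≤ jb ζ ^ s2 := Real.rpow_nonneg (by linarith [jb_ge_one ζ]) _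
  have q3 : 0 ≤ jb ϑ ^ (m - (msize γ : ℝ)) := Real.rpow_nonneg (by linarith [jb_ge_one ϑ]) _
  calc _ ≤ C * ((1 + n : ℝ) ^ L * (1 + ‖x‖) ^ L) * ((1 + n : ℝ) ^ L * (1 + ‖ζ‖) ^ L) *
        ((1 + n : ℝ) ^ M * (1 + ‖ϑ‖) ^ M) := by gcongr
    _ = _ := by ring

lemma Amp.slow {σ κ l w m : ℝ} {a : (Fin n → ℝ) → (Fin n → ℝ) → (Fin n → ℝ) → E}
    (ha : Amp σ κ l w m a) (γ : Fin n → ℕ) :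
    Slow ⌈|m|⌉₊ (fun x ζ => pdm γ (a x ζ)) := by
  have h := ha.slow_aux 0 γ
  simp only [pdm_zero] at h
  exact h

lemma Amp.admI {σ κ l w m : ℝ} {a : (Fin n → ℝ) → (Fin n → ℝ) → (Fin n → ℝ) → E}
    (ha : Amp σ κ l w m a) (i : Fin n) (γ : Fin n → ℕ) :
    AdmI i ⌈|m|⌉₊ (fun x ζ => pdm γ (a x ζ)) := by
  have hs : Sm3 a := ha.1
  refine ⟨hs.pdm_theta γ, fun k => ?_⟩
  obtain ⟨C, L, hC, hb⟩ := ha.slow_aux (Pi.single i k) γ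
  refine ⟨C, L, hC, fun x ζ ϑ => ?_⟩
  have h0 := hb x ζ ϑ
  beta_reduce at h0
  rw [pdm_single i k ((hs.pdm_theta γ).zeta x ϑ)] at h0
  exact h0

/-- The oscillating exponential. -/
def ee (ϑ ζ : Fin n → ℝ) : ℂ := Complex.exp (2 * Real.pi * Complex.I * (ip ϑ ζ : ℂ))

/-- An integrable weight. -/
def rho (v : Fin n → ℝ) : ℝ := ((1 + ‖v‖) ^ (n + 1))⁻¹

lemma rho_nonneg (v : Fin n → ℝ) : 0 ≤ rho v := by unfold rho; positivity

lemma rho_integrable : Integrable (rho : (Fin n → ℝ) → ℝ) := by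
  have h := integrable_one_add_norm (E := Fin n → ℝ) (μ := volume) (r := ((n + 1 : ℕ) : ℝ))
    (by simp)
  refine h.congr (Filter.Eventually.of_forall fun v => ?_)
  simp only [rho]
  rw [Real.rpow_neg (by positivity), Real.rpow_natCast]

lemma ip_comm (ϑ ζ : Fin n → ℝ) : ip ϑ ζ = ip ζ ϑ := by
  unfold ip; exact Finset.sum_congr rfl fun i _ => mul_comm _ _

lemma ee_comm (ϑ ζ : Fin n → ℝ) : ee ϑ ζ = ee ζ ϑ := by unfold ee; rw [ip_comm]

lemma norm_ee (ϑ ζ : Fin n → ℝ) : ‖ee ϑ ζ‖ = 1 := by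
  unfold ee
  have : (2 * Real.pi * Complex.I * (ip ϑ ζ : ℂ)) = ((2 * Real.pi * ip ϑ ζ : ℝ) : ℂ) * Complex.I := by
    push_cast; ring
  rw [this, Complex.norm_exp_ofReal_mul_I]

lemma continuous_ee : Continuous (fun p : (Fin n → ℝ) × (Fin n → ℝ) => ee p.1 p.2) := by
  unfold ee ip
  fun_prop

lemma ip_line (i : Fin n) (ϑ ζ : Fin n → ℝ) (t : ℝ) :
    ip (ϑ + t • Pi.single i 1) ζ = ip ϑ ζ + t * ζ i := by
  unfold ip
  simp [add_mul, Finset.sum_add_distrib, Pi.single_apply]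

lemma ee_line (i : Fin n) (ϑ ζ : Fin n → ℝ) (t : ℝ) :
    HasDerivAt (fun s : ℝ => ee (ϑ + s • Pi.single i 1) ζ)
      (2 * Real.pi * Complex.I * (ζ i : ℂ) * ee (ϑ + t • Pi.single i 1) ζ) t := by
  unfold ee
  simp only [ip_line]
  have h1 : HasDerivAt (fun s : ℝ => ((ip ϑ ζ + s * ζ i : ℝ) : ℂ)) ((ζ i : ℝ) : ℂ) t := by
    apply HasDerivAt.ofReal_comp
    simpa using ((hasDerivAt_id t).mul_const (ζ i)).const_add (ip ϑ ζ)
  have h2 := (h1.const_mul (2 * Real.pi * Complex.I : ℂ)).cexp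
  convert h2 using 1
  ring

lemma pd_line (i : Fin n) {f : (Fin n → ℝ) → E} (hf : ContDiff ℝ (⊤ : ℕ∞) f)
    (y : Fin n → ℝ) (t : ℝ) :
    HasDerivAt (fun s : ℝ => f (y + s • Pi.single i 1)) (pd i f (y + t • Pi.single i 1)) t := by
  have h1 : HasDerivAt (fun s : ℝ => y + s • (Pi.single i 1 : Fin n → ℝ)) (Pi.single i 1) t := by
    simpa using ((hasDerivAt_id t).smul_const (Pi.single i 1 : Fin n → ℝ)).const_add y
  exact ((hf.differentiable (by simp)) _).hasFDerivAt.comp_hasDerivAt t h1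

lemma schwartz_bound (v : SchwartzMap ((Fin n → ℝ) × (Fin n → ℝ)) E) (K : ℕ) :
    ∃ D : ℝ, 0 ≤ D ∧ ∀ x ζ, ‖v (x, ζ)‖ ≤ D * ((1 + ‖x‖) ^ K)⁻¹ * ((1 + ‖ζ‖) ^ K)⁻¹ := by
  obtain ⟨D, h⟩ : ∃ D : ℝ, ∀ p, (1 + ‖p‖) ^ (2 * K) * ‖v p‖ ≤ D := by
    refine ⟨2 ^ (2 * K) * (Finset.Iic (2 * K, 0)).sup
      (fun m => SchwartzMap.seminorm ℝ m.1 m.2) v, fun p => ?_⟩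
    have h := SchwartzMap.one_add_le_sup_seminorm_apply (𝕜 := ℝ) (m := (2 * K, 0)) (k := 2 * K)
      (n := 0) le_rfl le_rfl v p
    rw [norm_iteratedFDeriv_zero] at h
    exact h
  refine ⟨D, le_trans (by positivity) (h 0), fun x ζ => ?_⟩
  · replace h := h (x, ζ)
    rw [← div_eq_mul_inv, ← div_eq_mul_inv, le_div_iff₀ (by positivity), le_div_iff₀ (by positivity)]
    refine le_trans ?_ h
    have hx : ‖x‖ ≤ ‖(x, ζ)‖ := by simp [Prod.norm_def]
    have hz : ‖ζ‖ ≤ ‖(x, ζ)‖ := by simp [Prod.norm_def]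
    calc ‖v (x, ζ)‖ * (1 + ‖ζ‖) ^ K * (1 + ‖x‖) ^ K
        ≤ ‖v (x, ζ)‖ * (1 + ‖(x, ζ)‖) ^ K * (1 + ‖(x, ζ)‖) ^ K := by gcongr
      _ = _ := by rw [two_mul, pow_add]; ring

variable (T : E →L[ℝ] E →L[ℝ] ℂ)

lemma base_bound {M : ℕ} {A : (Fin n → ℝ) → (Fin n → ℝ) → (Fin n → ℝ) → E} (hA : Slow M A)
    (v : SchwartzMap ((Fin n → ℝ) × (Fin n → ℝ)) E) :
    ∃ C : ℝ, 0 ≤ C ∧ ∀ x ζ ϑ, ‖ee ϑ ζ * T (A x ζ ϑ) (v (x, ζ))‖ ≤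
      C * rho x * (1 + ‖ϑ‖) ^ M * rho ζ := by
  obtain ⟨C, L, hC, hb⟩ := hA
  obtain ⟨D, hD, hv⟩ := schwartz_bound v (L + (n + 1))
  refine ⟨‖T‖ * C * D, by positivity, fun x ζ ϑ => ?_⟩
  rw [norm_mul, norm_ee, one_mul]
  refine (T.le_opNorm₂ _ _).trans ?_
  calc ‖T‖ * ‖A x ζ ϑ‖ * ‖v (x, ζ)‖
      ≤ ‖T‖ * (C * (1 + ‖x‖) ^ L * (1 + ‖ζ‖) ^ L * (1 + ‖ϑ‖) ^ M) *
        (D * ((1 + ‖x‖) ^ (L + (n + 1)))⁻¹ * ((1 + ‖ζ‖) ^ (L + (n + 1)))⁻¹) := by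
        gcongr
        · exact hb x ζ ϑ
        · exact hv x ζ
    _ = _ := by
        unfold rho
        rw [pow_add, pow_add]
        have h1 : (1 + ‖x‖) ≠ 0 := by positivity
        have h2 : (1 + ‖ζ‖) ≠ 0 := by positivity
        field_simp
        ring

/-- The inner integral. -/
def FF (A : (Fin n → ℝ) → (Fin n → ℝ) → (Fin n → ℝ) → E)
    (v : SchwartzMap ((Fin n → ℝ) × (Fin n → ℝ)) E) (x ϑ : Fin n → ℝ) : ℂ :=
  ∫ ζ, ee ϑ ζ * T (A x ζ ϑ) (v (x, ζ))

lemma GG_continuous {A : (Fin n → ℝ) → (Fin n → ℝ) → (Fin n → ℝ) → E} (hA : Sm3 A)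
    (v : SchwartzMap ((Fin n → ℝ) × (Fin n → ℝ)) E) :
    Continuous (fun p : ((Fin n → ℝ) × (Fin n → ℝ)) × (Fin n → ℝ) =>
      ee p.1.2 p.2 * T (A p.1.1 p.2 p.1.2) (v (p.1.1, p.2))) := by
  have h1 : Continuous (fun p : ((Fin n → ℝ) × (Fin n → ℝ)) × (Fin n → ℝ) => ee p.1.2 p.2) :=
    continuous_ee.comp (f := fun p : ((Fin n → ℝ) × (Fin n → ℝ)) × (Fin n → ℝ) => (p.1.2, p.2))
      (by fun_prop)
  have h2 : Continuous (fun p : ((Fin n → ℝ) × (Fin n → ℝ)) × (Fin n → ℝ) =>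
      A p.1.1 p.2 p.1.2) :=
    (ContDiff.continuous hA).comp
      (f := fun p : ((Fin n → ℝ) × (Fin n → ℝ)) × (Fin n → ℝ) => ((p.1.1, p.2), p.1.2))
      (by fun_prop)
  have h3 : Continuous (fun p : ((Fin n → ℝ) × (Fin n → ℝ)) × (Fin n → ℝ) => v (p.1.1, p.2)) :=
    v.continuous.comp (by fun_prop)
  exact h1.mul ((T.continuous.comp h2).clm_apply h3)

lemma GG_integrable {M : ℕ} {A : (Fin n → ℝ) → (Fin n → ℝ) → (Fin n → ℝ) → E} (hA : Sm3 A)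
    (hS : Slow M A) (v : SchwartzMap ((Fin n → ℝ) × (Fin n → ℝ)) E) (x ϑ : Fin n → ℝ) :
    Integrable (fun ζ => ee ϑ ζ * T (A x ζ ϑ) (v (x, ζ))) := by
  obtain ⟨C, hC, hb⟩ := base_bound T hS v
  refine (rho_integrable.const_mul (C * rho x * (1 + ‖ϑ‖) ^ M)).mono'
    ?_ (Filter.Eventually.of_forall fun ζ => hb x ζ ϑ)
  exact ((GG_continuous T hA v).comp (f := fun ζ : Fin n → ℝ => ((x, ϑ), ζ))
    (by fun_prop)).aestronglyMeasurable

lemma FF_stronglyMeasurable {A : (Fin n → ℝ) → (Fin n → ℝ) → (Fin n → ℝ) → E} (hA : Sm3 A)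
    (v : SchwartzMap ((Fin n → ℝ) × (Fin n → ℝ)) E) :
    StronglyMeasurable (fun q : (Fin n → ℝ) × (Fin n → ℝ) => FF T A v q.1 q.2) :=
  (GG_continuous T hA v).stronglyMeasurable.integral_prod_right

/-- The `ζ_i`-derivative of a Schwartz function. -/
def dz (i : Fin n) (v : SchwartzMap ((Fin n → ℝ) × (Fin n → ℝ)) E) :
    SchwartzMap ((Fin n → ℝ) × (Fin n → ℝ)) E :=
  LineDeriv.lineDerivOp ((0, Pi.single i 1) : (Fin n → ℝ) × (Fin n → ℝ)) v

lemma dz_line (i : Fin n) (v : SchwartzMap ((Fin n → ℝ) × (Fin n → ℝ)) E) (x ζ : Fin n → ℝ)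
    (t : ℝ) :
    HasDerivAt (fun s : ℝ => v (x, ζ + s • Pi.single i 1)) (dz i v (x, ζ + t • Pi.single i 1)) t := by
  have h1 : HasDerivAt (fun s : ℝ => ζ + s • (Pi.single i 1 : Fin n → ℝ)) (Pi.single i 1) t := by
    simpa using ((hasDerivAt_id t).smul_const (Pi.single i 1 : Fin n → ℝ)).const_add ζ
  have h2 : HasDerivAt (fun s : ℝ => (x, ζ + s • (Pi.single i 1 : Fin n → ℝ)))
      ((0, Pi.single i 1) : (Fin n → ℝ) × (Fin n → ℝ)) t := (hasDerivAt_const t x).prodMk h1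
  have h3 := (v.differentiable (x, ζ + t • (Pi.single i 1 : Fin n → ℝ))).hasFDerivAt.comp_hasDerivAt
    t h2
  exact h3

lemma ibp_zeta {i : Fin n} {M : ℕ} {A : (Fin n → ℝ) → (Fin n → ℝ) → (Fin n → ℝ) → E}
    (hA : AdmI i M A) (v : SchwartzMap ((Fin n → ℝ) × (Fin n → ℝ)) E) (x ϑ : Fin n → ℝ) :
    FF T (fun x ζ ϑ => pd i (fun ζ' => A x ζ' ϑ) ζ) v x ϑ + FF T A (dz i v) x ϑ
      = - ((2 * Real.pi * Complex.I * (ϑ i : ℂ)) * FF T A v x ϑ) := by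
  have i0 := GG_integrable T hA.1 hA.slow v x ϑ
  have i1 := GG_integrable T hA.pd_zeta.1 hA.pd_zeta.slow v x ϑ
  have i2 := GG_integrable T hA.1 hA.slow (dz i v) x ϑ
  have key := integral_bilinear_hasLineDerivAt_right_eq_neg_left_of_integrable
    (μ := (volume : Measure (Fin n → ℝ))) (v := (Pi.single i 1 : Fin n → ℝ))
    (f := fun ζ => ee ϑ ζ) (f' := fun ζ => 2 * Real.pi * Complex.I * (ϑ i : ℂ) * ee ϑ ζ)
    (g := fun ζ => T (A x ζ ϑ) (v (x, ζ)))
    (g' := fun ζ => T (pd i (fun ζ' => A x ζ' ϑ) ζ) (v (x, ζ)) + T (A x ζ ϑ) (dz i v (x, ζ)))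
    (B := ContinuousLinearMap.mul ℝ ℂ) ?_ ?_ ?_ ?_ ?_
  · simp only [ContinuousLinearMap.mul_apply'] at key
    simp only [mul_add] at key
    rw [integral_add i1 i2] at key
    simp only [mul_assoc] at key
    simp only [integral_const_mul] at key
    unfold FF
    rw [key]
    simp only [mul_assoc]
  · simp only [ContinuousLinearMap.mul_apply']
    refine (i0.const_mul (2 * Real.pi * Complex.I * (ϑ i : ℂ))).congr
      (Filter.Eventually.of_forall fun ζ => ?_)
    simp only [mul_assoc]
  · simp only [ContinuousLinearMap.mul_apply', mul_add]
    exact i1.add i2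
  · exact i0
  · intro ζ _
    have h := ee_line i ζ ϑ 0
    simp only [zero_smul, add_zero] at h
    simp only [ee_comm _ ϑ] at h
    exact h
  · intro ζ _
    have h1 := pd_line i (hA.1.zeta x ϑ) ζ 0
    have h2 := dz_line i v x ζ 0
    have h3 := (T.hasFDerivAt.comp_hasDerivAt 0 h1).clm_apply h2
    simp only [zero_smul, add_zero, Function.comp_def] at h3
    exact h3

lemma decay (i : Fin n) (M k : ℕ) :
    ∀ (A : (Fin n → ℝ) → (Fin n → ℝ) → (Fin n → ℝ) → E), AdmI i M A →
    ∀ v : SchwartzMap ((Fin n → ℝ) × (Fin n → ℝ)) E,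
    ∃ C : ℝ, 0 ≤ C ∧ ∀ x ϑ, |ϑ i| ^ k * ‖FF T A v x ϑ‖ ≤ C * rho x * (1 + ‖ϑ‖) ^ M := by
  induction k with
  | zero =>
    intro A hA v
    obtain ⟨C, hC, hb⟩ := base_bound T hA.slow v
    have hI : 0 ≤ ∫ ζ : Fin n → ℝ, rho ζ := integral_nonneg fun ζ => rho_nonneg ζ
    refine ⟨C * ∫ ζ : Fin n → ℝ, rho ζ, by positivity, fun x ϑ => ?_⟩
    rw [pow_zero, one_mul]
    refine (norm_integral_le_of_norm_le (rho_integrable.const_mul (C * rho x * (1 + ‖ϑ‖) ^ M))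
      (Filter.Eventually.of_forall fun ζ => hb x ζ ϑ)).trans (le_of_eq ?_)
    rw [integral_const_mul]
    ring
  | succ k ih =>
    intro A hA v
    obtain ⟨C1, hC1, hb1⟩ := ih _ hA.pd_zeta v
    obtain ⟨C2, hC2, hb2⟩ := ih _ hA (dz i v)
    refine ⟨C1 + C2, by positivity, fun x ϑ => ?_⟩
    have h := ibp_zeta T hA v x ϑ
    have h' := congrArg norm h
    rw [norm_neg, norm_mul] at h'
    have hn : ‖(2 * Real.pi * Complex.I * (ϑ i : ℂ))‖ = 2 * Real.pi * |ϑ i| := by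
      simp [abs_of_pos Real.pi_pos]
    rw [hn] at h'
    have h1 : |ϑ i| * ‖FF T A v x ϑ‖ ≤ 2 * Real.pi * |ϑ i| * ‖FF T A v x ϑ‖ := by
      have := Real.pi_gt_three
      have h0 : 0 ≤ |ϑ i| * ‖FF T A v x ϑ‖ := by positivity
      nlinarith
    rw [← h'] at h1
    have h2 := h1.trans (norm_add_le _ _)
    calc |ϑ i| ^ (k + 1) * ‖FF T A v x ϑ‖ = |ϑ i| ^ k * (|ϑ i| * ‖FF T A v x ϑ‖) := by ring
      _ ≤ |ϑ i| ^ k * (_ + _) := by gcongr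
      _ = _ := mul_add _ _ _
      _ ≤ _ := add_le_add (hb1 x ϑ) (hb2 x ϑ)
      _ = _ := by ring

lemma FF_bound {M : ℕ} {A : (Fin n → ℝ) → (Fin n → ℝ) → (Fin n → ℝ) → E}
    (hS : Slow M A) (hA : ∀ i, AdmI i M A)
    (v : SchwartzMap ((Fin n → ℝ) × (Fin n → ℝ)) E) :
    ∃ C : ℝ, 0 ≤ C ∧ ∀ x ϑ, ‖FF T A v x ϑ‖ ≤ C * rho x * rho ϑ := by
  obtain ⟨C0, hC0, hb0⟩ : ∃ C : ℝ, 0 ≤ C ∧ ∀ x ϑ,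
      ‖FF T A v x ϑ‖ ≤ C * rho x * (1 + ‖ϑ‖) ^ M := by
    obtain ⟨C, hC, hb⟩ := base_bound T hS v
    have hI : 0 ≤ ∫ ζ : Fin n → ℝ, rho ζ := integral_nonneg fun ζ => rho_nonneg ζ
    refine ⟨C * ∫ ζ : Fin n → ℝ, rho ζ, by positivity, fun x ϑ => ?_⟩
    refine (norm_integral_le_of_norm_le (rho_integrable.const_mul (C * rho x * (1 + ‖ϑ‖) ^ M))
      (Filter.Eventually.of_forall fun ζ => hb x ζ ϑ)).trans (le_of_eq ?_)
    rw [integral_const_mul]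
    ring
  set K := M + (n + 1) with hK
  choose C hC hb using fun i => decay T i M K A (hA i) v
  have hsum : 0 ≤ ∑ i, C i := Finset.sum_nonneg fun i _ => hC i
  refine ⟨2 ^ K * (C0 + ∑ i, C i), by positivity, fun x ϑ => ?_⟩
  have hpow : (1 + ‖ϑ‖) ^ K ≤ 2 ^ K * (1 + ∑ i, |ϑ i| ^ K) := by
    have hs : 0 ≤ ∑ i, |ϑ i| ^ K := Finset.sum_nonneg fun i _ => by positivity
    by_cases h1 : ‖ϑ‖ ≤ 1
    · calc (1 + ‖ϑ‖) ^ K ≤ 2 ^ K := by gcongr; linarith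
        _ ≤ _ := le_mul_of_one_le_right (by positivity) (by linarith)
    · push Not at h1
      have hex : ∃ i, ‖ϑ‖ ≤ |ϑ i| := by
        by_contra hcon
        push Not at hcon
        have := (pi_norm_lt_iff (x := ϑ) (by linarith : (0:ℝ) < ‖ϑ‖)).2
          (fun i => by simpa using hcon i)
        exact lt_irrefl _ this
      obtain ⟨i, hi⟩ := hex
      have h2 : |ϑ i| ^ K ≤ ∑ i, |ϑ i| ^ K :=
        Finset.single_le_sum (f := fun i => |ϑ i| ^ K) (fun j _ => by positivity)
          (Finset.mem_univ i)
      calc (1 + ‖ϑ‖) ^ K ≤ (2 * |ϑ i|) ^ K := by gcongr; linarith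
        _ = 2 ^ K * |ϑ i| ^ K := mul_pow _ _ _
        _ ≤ _ := by gcongr; linarith
  have hmain : (1 + ‖ϑ‖) ^ K * ‖FF T A v x ϑ‖ ≤
      2 ^ K * (C0 + ∑ i, C i) * rho x * (1 + ‖ϑ‖) ^ M := by
    calc (1 + ‖ϑ‖) ^ K * ‖FF T A v x ϑ‖
        ≤ 2 ^ K * (1 + ∑ i, |ϑ i| ^ K) * ‖FF T A v x ϑ‖ := by gcongr
      _ = 2 ^ K * (‖FF T A v x ϑ‖ + ∑ i, |ϑ i| ^ K * ‖FF T A v x ϑ‖) := by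
          rw [← Finset.sum_mul]; ring
      _ ≤ 2 ^ K * (C0 * rho x * (1 + ‖ϑ‖) ^ M + ∑ i, C i * rho x * (1 + ‖ϑ‖) ^ M) := by
          refine mul_le_mul_of_nonneg_left ?_ (by positivity)
          exact add_le_add (hb0 x ϑ) (Finset.sum_le_sum fun i _ => hb i x ϑ)
      _ = _ := by rw [← Finset.sum_mul, ← Finset.sum_mul]; ring
  have hp : 0 < (1 + ‖ϑ‖) ^ M := by positivity
  rw [hK, pow_add] at hmain
  rw [← hK] at hmain
  have h5 : (1 + ‖ϑ‖) ^ (n + 1) * ‖FF T A v x ϑ‖ ≤ 2 ^ K * (C0 + ∑ i, C i) * rho x := by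
    refine le_of_mul_le_mul_right ?_ hp
    linarith
  conv_rhs => rw [show rho ϑ = ((1 + ‖ϑ‖) ^ (n + 1))⁻¹ from rfl]
  rw [← div_eq_mul_inv, le_div_iff₀ (by positivity)]
  linarith

lemma FF_integrable {M : ℕ} {A : (Fin n → ℝ) → (Fin n → ℝ) → (Fin n → ℝ) → E}
    (hs : Sm3 A) (hS : Slow M A) (hA : ∀ i, AdmI i M A)
    (v : SchwartzMap ((Fin n → ℝ) × (Fin n → ℝ)) E) :
    Integrable (fun q : (Fin n → ℝ) × (Fin n → ℝ) => FF T A v q.1 q.2) := by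
  obtain ⟨C, hC, hb⟩ := FF_bound T hS hA v
  refine ((rho_integrable.mul_prod rho_integrable).const_mul C).mono'
    (FF_stronglyMeasurable T hs v).aestronglyMeasurable
    (Filter.Eventually.of_forall fun q => ?_)
  rw [← mul_assoc]
  exact hb q.1 q.2

lemma FF_integrable_theta {M : ℕ} {A : (Fin n → ℝ) → (Fin n → ℝ) → (Fin n → ℝ) → E}
    (hs : Sm3 A) (hS : Slow M A) (hA : ∀ i, AdmI i M A)
    (v : SchwartzMap ((Fin n → ℝ) × (Fin n → ℝ)) E) (x : Fin n → ℝ) :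
    Integrable (fun ϑ => FF T A v x ϑ) := by
  obtain ⟨C, hC, hb⟩ := FF_bound T hS hA v
  refine (rho_integrable.const_mul (C * rho x)).mono'
    ((FF_stronglyMeasurable T hs v).comp_measurable
      (g := fun ϑ : Fin n → ℝ => (x, ϑ)) (by fun_prop)).aestronglyMeasurable
    (Filter.Eventually.of_forall fun ϑ => hb x ϑ)

lemma FF_line {i : Fin n} {M : ℕ} {A : (Fin n → ℝ) → (Fin n → ℝ) → (Fin n → ℝ) → E}
    (hs : Sm3 A) (hS : Slow M A) (hS' : Slow M (fun x ζ => pd i (A x ζ)))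
    (v v' : SchwartzMap ((Fin n → ℝ) × (Fin n → ℝ)) E)
    (hv : ∀ x ζ, v' (x, ζ) = ζ i • v (x, ζ)) (x ϑ : Fin n → ℝ) :
    HasLineDerivAt ℝ (fun ϑ => FF T A v x ϑ)
      ((2 * Real.pi * Complex.I) * FF T A v' x ϑ + FF T (fun x ζ => pd i (A x ζ)) v x ϑ) ϑ
      (Pi.single i 1) := by
  obtain ⟨C1, hC1, hb1⟩ := base_bound T hS v'
  obtain ⟨C2, hC2, hb2⟩ := base_bound T hS' v
  let e : Fin n → ℝ := Pi.single i 1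
  have he : ‖e‖ ≤ 1 := by simp [e, Pi.norm_single]
  let F' : ℝ → (Fin n → ℝ) → ℂ := fun t ζ =>
    (2 * Real.pi * Complex.I) * (ee (ϑ + t • e) ζ * T (A x ζ (ϑ + t • e)) (v' (x, ζ))) +
      ee (ϑ + t • e) ζ * T (pd i (A x ζ) (ϑ + t • e)) (v (x, ζ))
  have hint : ∀ ϑ, Integrable (fun ζ => (2 * Real.pi * Complex.I) *
      (ee ϑ ζ * T (A x ζ ϑ) (v' (x, ζ))) + ee ϑ ζ * T (pd i (A x ζ) ϑ) (v (x, ζ))) := fun ϑ =>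
    ((GG_integrable T hs hS v' x ϑ).const_mul _).add
      (GG_integrable T (hs.pd_theta i) hS' v x ϑ)
  have key := (hasDerivAt_integral_of_dominated_loc_of_deriv_le (𝕜 := ℝ)
    (μ := (volume : Measure (Fin n → ℝ))) (x₀ := (0 : ℝ)) (s := Metric.ball 0 1)
    (F := fun t ζ => ee (ϑ + t • e) ζ * T (A x ζ (ϑ + t • e)) (v (x, ζ)))
    (F' := F')
    (bound := fun ζ => (2 * Real.pi * (C1 * rho x * (2 + ‖ϑ‖) ^ M) +
      (C2 * rho x * (2 + ‖ϑ‖) ^ M)) * rho ζ)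
    (Metric.ball_mem_nhds 0 one_pos) ?_ ?_ ?_ ?_ ?_ ?_).2
  · have h0 : ∫ ζ, F' 0 ζ = (2 * Real.pi * Complex.I) * FF T A v' x ϑ +
        FF T (fun x ζ => pd i (A x ζ)) v x ϑ := by
      simp only [F', zero_smul, add_zero]
      rw [integral_add ((GG_integrable T hs hS v' x ϑ).const_mul _)
        (GG_integrable T (hs.pd_theta i) hS' v x ϑ), integral_const_mul]
      rfl
    rw [h0] at key
    exact key
  · exact Filter.Eventually.of_forall fun t =>
      (GG_integrable T hs hS v x (ϑ + t • e)).aestronglyMeasurable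
  · exact GG_integrable T hs hS v x (ϑ + (0 : ℝ) • e)
  · exact (hint _).aestronglyMeasurable
  · refine Filter.Eventually.of_forall fun ζ t ht => ?_
    have ht' : |t| < 1 := by simpa using ht
    have hn : 1 + ‖ϑ + t • e‖ ≤ 2 + ‖ϑ‖ := by
      have h1 := norm_add_le ϑ (t • e)
      rw [norm_smul, Real.norm_eq_abs] at h1
      have h2 : |t| * ‖e‖ ≤ 1 := mul_le_one₀ ht'.le (norm_nonneg _) he
      linarith
    have hr := rho_nonneg ζ
    have hx := rho_nonneg x
    have hc : ‖(2 * Real.pi * Complex.I : ℂ)‖ = 2 * Real.pi := by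
      simp [abs_of_pos Real.pi_pos]
    refine (norm_add_le _ _).trans ?_
    rw [norm_mul, hc]
    calc _ ≤ 2 * Real.pi * (C1 * rho x * (1 + ‖ϑ + t • e‖) ^ M * rho ζ) +
          C2 * rho x * (1 + ‖ϑ + t • e‖) ^ M * rho ζ := by
          gcongr
          · exact hb1 x ζ _
          · exact hb2 x ζ _
      _ ≤ 2 * Real.pi * (C1 * rho x * (2 + ‖ϑ‖) ^ M * rho ζ) +
          C2 * rho x * (2 + ‖ϑ‖) ^ M * rho ζ := by gcongr
      _ = _ := by ring
  · exact rho_integrable.const_mul _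
  · refine Filter.Eventually.of_forall fun ζ t _ => ?_
    have h1 := ee_line i ϑ ζ t
    have h2 := (T.hasFDerivAt.comp_hasDerivAt t (pd_line i (hs.theta x ζ) ϑ t)).clm_apply
      (hasDerivAt_const t (v (x, ζ)))
    refine HasDerivAt.congr_deriv (h1.mul h2) ?_
    simp only [F', hv, e, map_smul, Complex.real_smul, map_zero, add_zero, Function.comp_def]
    ring

lemma FF_step {i : Fin n} {M : ℕ} {A : (Fin n → ℝ) → (Fin n → ℝ) → (Fin n → ℝ) → E}
    (hs : Sm3 A) (hS : Slow M A) (hA : ∀ i, AdmI i M A)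
    (hS' : Slow M (fun x ζ => pd i (A x ζ))) (hA' : ∀ j, AdmI j M (fun x ζ => pd i (A x ζ)))
    (v v' : SchwartzMap ((Fin n → ℝ) × (Fin n → ℝ)) E)
    (hv : ∀ x ζ, v' (x, ζ) = ζ i • v (x, ζ)) (x : Fin n → ℝ) :
    ∫ ϑ, FF T A v' x ϑ =
      (Complex.I / (2 * Real.pi)) * ∫ ϑ, FF T (fun x ζ => pd i (A x ζ)) v x ϑ := by
  have i0 := FF_integrable_theta T hs hS hA v x
  have i1 := FF_integrable_theta T hs hS hA v' x
  have i2 := FF_integrable_theta T (hs.pd_theta i) hS' hA' v x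
  have key := integral_bilinear_hasLineDerivAt_right_eq_neg_left_of_integrable
    (μ := (volume : Measure (Fin n → ℝ))) (v := (Pi.single i 1 : Fin n → ℝ))
    (f := fun _ => (1 : ℂ)) (f' := fun _ => 0)
    (g := fun ϑ => FF T A v x ϑ)
    (g' := fun ϑ => (2 * Real.pi * Complex.I) * FF T A v' x ϑ +
      FF T (fun x ζ => pd i (A x ζ)) v x ϑ)
    (B := ContinuousLinearMap.mul ℝ ℂ) (by simp)
    (by
      simp only [ContinuousLinearMap.mul_apply', one_mul]
      exact (i1.const_mul (2 * Real.pi * Complex.I)).add i2) (by simpa using i0)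
    (fun ϑ _ => hasDerivAt_const _ _)
    (fun ϑ _ => FF_line T hs hS hS' v v' hv x ϑ)
  simp only [ContinuousLinearMap.mul_apply', one_mul, zero_mul, integral_zero, neg_zero] at key
  rw [integral_add (i1.const_mul _) i2, integral_const_mul] at key
  have hpi : (Real.pi : ℂ) ≠ 0 := by exact_mod_cast Real.pi_ne_zero
  have hq := eq_neg_of_add_eq_zero_right key
  rw [hq]
  field_simp
  linear_combination (∫ ϑ, FF T A v' x ϑ) * Complex.I_sq

lemma exists_mul_schwartz (β : Fin n → ℕ) (v : SchwartzMap ((Fin n → ℝ) × (Fin n → ℝ)) E) :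
    ∃ w : SchwartzMap ((Fin n → ℝ) × (Fin n → ℝ)) E,
      ∀ x ζ, w (x, ζ) = (∏ i, ζ i ^ β i) • v (x, ζ) := by
  have hg : Function.HasTemperateGrowth
      (fun p : (Fin n → ℝ) × (Fin n → ℝ) => ∏ i, p.2 i ^ β i) := by
    suffices h : ∀ s : Finset (Fin n), Function.HasTemperateGrowth
        (fun p : (Fin n → ℝ) × (Fin n → ℝ) => ∏ i ∈ s, p.2 i ^ β i) from h Finset.univ
    intro s
    induction s using Finset.induction_on with
    | empty => simpa using Function.HasTemperateGrowth.const (1 : ℝ)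
    | insert i s hi ih =>
    simp only [Finset.prod_insert hi]
    refine Function.HasTemperateGrowth.mul (Function.HasTemperateGrowth.pow ?_ _) ih
    exact ((ContinuousLinearMap.proj (R := ℝ) (φ := fun _ : Fin n => ℝ) i).comp
      (ContinuousLinearMap.snd ℝ (Fin n → ℝ) (Fin n → ℝ))).hasTemperateGrowth
  refine ⟨SchwartzMap.smulLeftCLM E (fun p : (Fin n → ℝ) × (Fin n → ℝ) => ∏ i, p.2 i ^ β i) v,
    fun x ζ => ?_⟩
  rw [SchwartzMap.smulLeftCLM_apply_apply hg]

lemma FF_main {σ κ l w m : ℝ} {a : (Fin n → ℝ) → (Fin n → ℝ) → (Fin n → ℝ) → E}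
    (ha : Amp σ κ l w m a) (d : ℕ) : ∀ (β : Fin n → ℕ), msize β = d → ∀ (γ : Fin n → ℕ)
    (v w : SchwartzMap ((Fin n → ℝ) × (Fin n → ℝ)) E),
    (∀ x ζ, w (x, ζ) = (∏ i, ζ i ^ β i) • v (x, ζ)) → ∀ x,
    ∫ ϑ, FF T (fun x ζ => pdm γ (a x ζ)) w x ϑ =
      (Complex.I / (2 * Real.pi)) ^ d * ∫ ϑ, FF T (fun x ζ => pdm (γ + β) (a x ζ)) v x ϑ := by
  have hs : Sm3 a := ha.1
  induction d with
  | zero =>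
    intro β hβ γ v w hw x
    have h0 : β = 0 := by
      funext i
      exact Finset.sum_eq_zero_iff.1 hβ i (Finset.mem_univ i)
    subst h0
    have : w = v := by
      ext ⟨x, ζ⟩
      simp [hw]
    simp [this]
  | succ d ih =>
    intro β hβ γ v w hw x
    obtain ⟨i, hi⟩ : ∃ i, β i ≠ 0 := by
      by_contra hcon
      push Not at hcon
      have : msize β = 0 := by unfold msize; simp [hcon]
      omega
    obtain ⟨β', rfl⟩ : ∃ β' : Fin n → ℕ, β = β' + Pi.single i 1 := by
      refine ⟨β - Pi.single i 1, ?_⟩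
      funext j
      by_cases hj : j = i
      · subst hj; simp; omega
      · simp [hj]
    have hβ' : msize β' = d := by
      unfold msize at hβ ⊢
      simp only [Pi.add_apply, Finset.sum_add_distrib, Finset.sum_pi_single', Finset.mem_univ,
        if_true] at hβ
      simp at hβ
      exact hβ
    obtain ⟨v', hv'⟩ := exists_mul_schwartz (Pi.single i 1) v
    have hv : ∀ x ζ, v' (x, ζ) = ζ i • v (x, ζ) := by
      intro x ζ
      rw [hv', Finset.prod_eq_single i]
      · simp
      · intro j _ hj; simp [hj]
      · simp
    have hw' : ∀ x ζ, w (x, ζ) = (∏ i, ζ i ^ β' i) • v' (x, ζ) := by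
      intro x ζ
      rw [hw, hv', smul_smul, ← Finset.prod_mul_distrib]
      simp only [Pi.add_apply, pow_add]
    have hpd : (fun x ζ => pdm (γ + β' + Pi.single i 1) (a x ζ)) =
        fun x ζ => pd i (pdm (γ + β') (a x ζ)) := by
      funext x ζ
      exact pdm_add_single i (γ + β') (hs.theta x ζ)
    have hS' := ha.slow (γ + β' + Pi.single i 1)
    have hA' := fun j => ha.admI j (γ + β' + Pi.single i 1)
    rw [← add_assoc, ih β' hβ' γ v' w hw' x]
    rw [hpd] at hS' ⊢
    simp only [hpd] at hA'
    rw [FF_step T (hs.pdm_theta (γ + β')) (ha.slow (γ + β')) (fun j => ha.admI j (γ + β'))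
      hS' hA' v v' hv x]
    rw [pow_succ]
    ring

end Helpers

/-- For an amplitude `a ∈ Π_{σ,κ}^{l,w,m}` and a Schwartz `u`, the
oscillatory integrals `R_{β,u}(a)` and `S_{β,u}(a)` are well defined and equal:
multiplication by `ζ^β` under the integral equals `(i/2π)^{|β|} ∂_ϑ^β`. -/
theorem statement10 {n N : ℕ} (hN : 0 < N)
    (σ κ l w m : ℝ) (hσ : σ ∈ Set.Icc (0 : ℝ) 1) (hκ : 0 ≤ κ)
    (a : (Fin n → ℝ) → (Fin n → ℝ) → (Fin n → ℝ) → Matrix (Fin N) (Fin N) ℂ)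
    (ha : Amp σ κ l w m a)
    (u : SchwartzMap ((Fin n → ℝ) × (Fin n → ℝ)) (Matrix (Fin N) (Fin N) ℂ))
    (β : Fin n → ℕ) :
    (∀ x ϑ, Integrable (fun ζ : Fin n → ℝ =>
      ((∏ i, ζ i ^ β i : ℝ) : ℂ) * Complex.exp (2 * Real.pi * Complex.I * (ip ϑ ζ : ℂ)) *
        Matrix.trace (a x ζ ϑ * u (x, ζ)))) ∧
    Integrable (fun q : (Fin n → ℝ) × (Fin n → ℝ) =>
      ∫ ζ, ((∏ i, ζ i ^ β i : ℝ) : ℂ) *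
        Complex.exp (2 * Real.pi * Complex.I * (ip q.2 ζ : ℂ)) *
        Matrix.trace (a q.1 ζ q.2 * u (q.1, ζ))) ∧
    (∀ x ϑ, Integrable (fun ζ : Fin n → ℝ =>
      Complex.exp (2 * Real.pi * Complex.I * (ip ϑ ζ : ℂ)) *
        Matrix.trace (pdm3 0 0 β a x ζ ϑ * u (x, ζ)))) ∧
    Integrable (fun q : (Fin n → ℝ) × (Fin n → ℝ) =>
      ∫ ζ, Complex.exp (2 * Real.pi * Complex.I * (ip q.2 ζ : ℂ)) *
        Matrix.trace (pdm3 0 0 β a q.1 ζ q.2 * u (q.1, ζ))) ∧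
    (∫ x, ∫ ϑ, ∫ ζ, ((∏ i, ζ i ^ β i : ℝ) : ℂ) *
        Complex.exp (2 * Real.pi * Complex.I * (ip ϑ ζ : ℂ)) *
        Matrix.trace (a x ζ ϑ * u (x, ζ))) =
      (Complex.I / (2 * Real.pi)) ^ (msize β) *
        ∫ x, ∫ ϑ, ∫ ζ, Complex.exp (2 * Real.pi * Complex.I * (ip ϑ ζ : ℂ)) *
          Matrix.trace (pdm3 0 0 β a x ζ ϑ * u (x, ζ)) := by
  have hs : Sm3 a := ha.1
  let T : Matrix (Fin N) (Fin N) ℂ →L[ℝ] Matrix (Fin N) (Fin N) ℂ →L[ℝ] ℂ :=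
    LinearMap.toContinuousBilinearMap
      (LinearMap.mk₂ ℝ (fun A B : Matrix (Fin N) (Fin N) ℂ => Matrix.trace (A * B))
        (fun A B C => by rw [add_mul, Matrix.trace_add])
        (fun c A B => by rw [Matrix.smul_mul, Matrix.trace_smul])
        (fun A B C => by rw [mul_add, Matrix.trace_add])
        (fun c A B => by rw [Matrix.mul_smul, Matrix.trace_smul]))
  have hT : ∀ A B, T A B = Matrix.trace (A * B) := fun A B => rfl
  obtain ⟨w', hw'⟩ := exists_mul_schwartz β u
  have e1 : ∀ x ϑ ζ : Fin n → ℝ, ((∏ i, ζ i ^ β i : ℝ) : ℂ) *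
      Complex.exp (2 * Real.pi * Complex.I * (ip ϑ ζ : ℂ)) *
        Matrix.trace (a x ζ ϑ * u (x, ζ)) =
      ee ϑ ζ * T ((fun x ζ => pdm 0 (a x ζ)) x ζ ϑ) (w' (x, ζ)) := by
    intro x ϑ ζ
    rw [hw', map_smul, hT, Complex.real_smul, ee]
    simp only [pdm_zero]
    ring
  have e2 : ∀ x ϑ ζ : Fin n → ℝ, Complex.exp (2 * Real.pi * Complex.I * (ip ϑ ζ : ℂ)) *
        Matrix.trace (pdm3 0 0 β a x ζ ϑ * u (x, ζ)) =
      ee ϑ ζ * T ((fun x ζ => pdm β (a x ζ)) x ζ ϑ) (u (x, ζ)) := by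
    intro x ϑ ζ
    rw [hT, ee]
    simp only [pdm3, pdm_zero]
  simp only [e1, e2]
  refine ⟨fun x ϑ => GG_integrable T (hs.pdm_theta 0) (ha.slow 0) w' x ϑ,
    FF_integrable T (hs.pdm_theta 0) (ha.slow 0) (fun i => ha.admI i 0) w',
    fun x ϑ => GG_integrable T (hs.pdm_theta β) (ha.slow β) u x ϑ,
    FF_integrable T (hs.pdm_theta β) (ha.slow β) (fun i => ha.admI i β) u, ?_⟩
  rw [← integral_const_mul]
  refine integral_congr_ae (Filter.Eventually.of_forall fun x => ?_)
  have h := FF_main T ha (msize β) β rfl 0 u w' hw' x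
  rw [zero_add] at h
  exact h
end
end

section
/- Let σ ∈ [0,1] and κ ≥ 0. (a) If P ∈ E_{σ,κ}^{w}(M_n(ℝ)), i.e. (x,ζ) ↦ P_{x,ζ} is a smooth M_n(ℝ)-valued function with ‖∂^ν P(x,ζ)‖ ≤ C_ν ⟨x⟩^{-σ|ν|}⟨ζ⟩^{w+κ|ν|} for all ν, then the map (x,ζ) ↦ P_{x,ζ}(ζ) belongs to H_{σ,κ}^{w+κ+1}(ℝ^n). (b) If f ∈ G_σ(ℝ^n, E) (E a finite-dimensional normed space) and g ∈ H_{σ,κ}^{w}(ℝ^n) are such that, in case σ ≠ 0, there exist c > 0 and r ≥ 0 with ⟨g(x,ζ)⟩ ≥ c⟨x⟩⟨ζ⟩^{-r} for all (x,ζ) ∈ ℝ^{2n}, then f ∘ g ∈ H_{σ, max{rσ,κ}+|w|}^{|w|}(E); moreover, if f ∈ G_σ(ℝ^n, ℝ^p), then (x,ζ) ↦ (df)_{g(x,ζ)} belongs to E_{σ, max{rσ,κ}+|w|}^{0}(M_{p,n}(ℝ)). -/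
open MeasureTheory
open scoped BigOperators

noncomputable section

attribute [local instance] Matrix.normedAddCommGroup Matrix.normedSpace

section Helpers

variable {ι W F : Type*} [NormedAddCommGroup W] [NormedSpace ℝ W]
  [NormedAddCommGroup F] [NormedSpace ℝ F]

/-- Iterated directional derivative along a list of directions. -/
def itd (e : ι → W) : List ι → (W → F) → W → F
  | [], f => f
  | i :: l, f => fun x => fderiv ℝ (itd e l f) x (e i)

lemma itd_append (e : ι → W) (l₁ l₂ : List ι) (f : W → F) :
    itd e (l₁ ++ l₂) f = itd e l₁ (itd e l₂ f) := by
  induction l₁ with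
  | nil => rfl
  | cons a l ih => simp only [List.cons_append, itd, ih]

lemma itd_smooth (e : ι → W) (l : List ι) {f : W → F} (hf : ContDiff ℝ (⊤ : ℕ∞) f) :
    ContDiff ℝ (⊤ : ℕ∞) (itd e l f) := by
  induction l with
  | nil => exact hf
  | cons a l ih =>
    have h : ContDiff ℝ (⊤ : ℕ∞) (fderiv ℝ (itd e l f)) := ih.fderiv_right (by simp)
    exact h.clm_apply contDiff_const

lemma itd_perm (e : ι → W) {l₁ l₂ : List ι} (h : l₁.Perm l₂) {f : W → F}
    (hf : ContDiff ℝ (⊤ : ℕ∞) f) : itd e l₁ f = itd e l₂ f := by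
  induction h with
  | nil => rfl
  | cons a _ ih => simp only [itd, ih]
  | trans _ _ ih₁ ih₂ => exact ih₁.trans ih₂
  | swap a b l =>
    have hs := itd_smooth e l hf
    have h1 : ContDiff ℝ (⊤ : ℕ∞) (fderiv ℝ (itd e l f)) := hs.fderiv_right (by simp)
    have hd : Differentiable ℝ (fderiv ℝ (itd e l f)) := h1.differentiable (by simp)
    funext x
    have hsym : IsSymmSndFDerivAt ℝ (itd e l f) x :=
      hs.contDiffAt.isSymmSndFDerivAt (by
        simp only [minSmoothness_of_isRCLikeNormedField]; exact WithTop.coe_le_coe.2 (le_top (a := (2 : ℕ∞))))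
    simp only [itd]
    rw [fderiv_clm_apply (hd x) (differentiableAt_const _),
      fderiv_clm_apply (hd x) (differentiableAt_const _)]
    simp
    exact hsym _ _

lemma itd_eq_iter (e : ι → W) {f : W → F} (hf : ContDiff ℝ (⊤ : ℕ∞) f) (k : ℕ)
    (t : Fin k → ι) (x : W) :
    itd e (List.ofFn t) f x = iteratedFDeriv ℝ k f x (fun i => e (t i)) := by
  induction k generalizing x with
  | zero => simp [itd]
  | succ k ih =>
    rw [List.ofFn_succ]
    simp only [itd]
    have hd : Differentiable ℝ (iteratedFDeriv ℝ k f) :=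
      hf.differentiable_iteratedFDeriv (by exact_mod_cast WithTop.coe_lt_top _)
    rw [DifferentiableAt.iteratedFDeriv_succ_apply_left' (hd x)]
    have : itd e (List.ofFn fun i : Fin k => t i.succ) f
        = fun y => iteratedFDeriv ℝ k f y (fun i => e (t i.succ)) := by
      funext y; exact ih _ y
    rw [this]
    rfl

lemma norm_itd_le (e : ι → W) (he : ∀ i, ‖e i‖ ≤ 1) {f : W → F}
    (hf : ContDiff ℝ (⊤ : ℕ∞) f) (l : List ι) (x : W) :
    ‖itd e l f x‖ ≤ ‖iteratedFDeriv ℝ l.length f x‖ := by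
  have h := itd_eq_iter e hf l.length l.get x
  rw [List.ofFn_get] at h
  rw [h]
  refine (ContinuousMultilinearMap.le_opNorm _ _).trans ?_
  have : ∏ i, ‖e (l.get i)‖ ≤ 1 := Finset.prod_le_one (fun i _ => norm_nonneg _) (fun i _ => he _)
  exact mul_le_of_le_one_right (norm_nonneg _) this

lemma iter_bound [Fintype ι] (e : ι → W) (co : ι → W → ℝ)
    (hco : ∀ w, ∑ i, co i w • e i = w) (hb : ∀ i w, |co i w| ≤ ‖w‖)
    {G : W → F} (hG : ContDiff ℝ (⊤ : ℕ∞) G) (k : ℕ) (B : W → ℝ) (hB : ∀ q, 0 ≤ B q)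
    (h : ∀ l : List ι, l.length = k → ∃ C > 0, ∀ q, ‖itd e l G q‖ ≤ C * B q) :
    ∃ C > 0, ∀ q, ‖iteratedFDeriv ℝ k G q‖ ≤ C * B q := by
  classical
  have h' : ∀ t : Fin k → ι, ∃ C > 0, ∀ q, ‖itd e (List.ofFn t) G q‖ ≤ C * B q :=
    fun t => h _ (by simp)
  choose C hC hCb using h'
  refine ⟨1 + ∑ t, C t, ?_, fun q => ?_⟩
  · have : 0 ≤ ∑ t, C t := Finset.sum_nonneg fun t _ => (hC t).le
    linarith
  have hS : 0 ≤ ∑ t, C t * B q :=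
    Finset.sum_nonneg fun t _ => mul_nonneg (hC t).le (hB q)
  have key : ‖iteratedFDeriv ℝ k G q‖ ≤ ∑ t, C t * B q := by
    refine ContinuousMultilinearMap.opNorm_le_bound hS fun m => ?_
    have hm : m = fun i => ∑ j, co j (m i) • e j := by
      funext i; exact (hco (m i)).symm
    conv_lhs => rw [hm]
    rw [ContinuousMultilinearMap.map_sum, Finset.sum_mul]
    refine (norm_sum_le _ _).trans (Finset.sum_le_sum fun t _ => ?_)
    rw [ContinuousMultilinearMap.map_smul_univ _ (fun i => co (t i) (m i)) (fun i => e (t i)),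
      norm_smul, ← itd_eq_iter e hG, mul_comm]
    refine mul_le_mul (hCb t q) ?_ (norm_nonneg _) (mul_nonneg (hC t).le (hB q))
    rw [Real.norm_eq_abs, Finset.abs_prod]
    exact Finset.prod_le_prod (fun i _ => abs_nonneg _) (fun i _ => hb _ _)
  refine key.trans ?_
  rw [← Finset.sum_mul]
  exact mul_le_mul_of_nonneg_right (by linarith) (hB q)

/-- The standard basis. -/
def e1 (n : ℕ) : Fin n → (Fin n → ℝ) := fun i => Pi.single i 1

/-- The standard basis of the product. -/
def e2 (n : ℕ) : Fin n ⊕ Fin n → (Fin n → ℝ) × (Fin n → ℝ) :=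
  Sum.elim (fun i => (Pi.single i 1, 0)) (fun i => (0, Pi.single i 1))

/-- List of indices of a multi-index. -/
def lidx {n : ℕ} (ν : Fin n → ℕ) : List (Fin n) :=
  (List.finRange n).flatMap fun i => List.replicate (ν i) i

lemma count_lidx {n : ℕ} (ν : Fin n → ℕ) (i : Fin n) : (lidx ν).count i = ν i := by
  rw [lidx, List.count_flatMap]
  have : (List.count i ∘ fun i => List.replicate (ν i) i) = fun j => if j = i then ν i else 0 := by
    funext j
    simp only [Function.comp, List.count_replicate, beq_iff_eq]
    split_ifs with h
    · rw [h]
    · rfl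
  rw [this, ← Fin.sum_univ_def]
  simp

lemma length_lidx {n : ℕ} (ν : Fin n → ℕ) : (lidx ν).length = msize ν := by
  rw [lidx, List.length_flatMap, msize, Fin.sum_univ_def]
  simp

lemma pd_iter {n : ℕ} (i : Fin n) (k : ℕ) (f : (Fin n → ℝ) → F) :
    (pd i)^[k] f = itd (e1 n) (List.replicate k i) f := by
  induction k with
  | zero => rfl
  | succ k ih => rw [Function.iterate_succ_apply', ih, List.replicate_succ]; rfl

lemma pdm_eq {n : ℕ} (ν : Fin n → ℕ) (f : (Fin n → ℝ) → F) :
    pdm ν f = itd (e1 n) (lidx ν) f := by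
  unfold pdm lidx
  induction List.finRange n with
  | nil => rfl
  | cons a l ih => rw [List.foldr_cons, ih, pd_iter, List.flatMap_cons, itd_append]

lemma itd_inr {n : ℕ} {G : (Fin n → ℝ) × (Fin n → ℝ) → F} (hG : ContDiff ℝ (⊤ : ℕ∞) G)
    (l : List (Fin n)) (x : Fin n → ℝ) :
    itd (e1 n) l (fun ζ => G (x, ζ)) = fun ζ => itd (e2 n) (l.map Sum.inr) G (x, ζ) := by
  induction l with
  | nil => rfl
  | cons a l ih =>
    funext ζ
    simp only [itd, ih, List.map_cons]
    have hd : DifferentiableAt ℝ (itd (e2 n) (l.map Sum.inr) G) (x, ζ) :=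
      (itd_smooth _ _ hG).differentiable (by simp) _
    have := hd.hasFDerivAt.comp ζ (hasFDerivAt_prodMk_right x ζ)
    have h2 := this.fderiv
    simp only [Function.comp_def] at h2
    rw [h2]
    rfl

lemma itd_inl {n : ℕ} {G : (Fin n → ℝ) × (Fin n → ℝ) → F} (hG : ContDiff ℝ (⊤ : ℕ∞) G)
    (l : List (Fin n)) (ζ : Fin n → ℝ) :
    itd (e1 n) l (fun x => G (x, ζ)) = fun x => itd (e2 n) (l.map Sum.inl) G (x, ζ) := by
  induction l with
  | nil => rfl
  | cons a l ih =>
    funext x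
    simp only [itd, ih, List.map_cons]
    have hd : DifferentiableAt ℝ (itd (e2 n) (l.map Sum.inl) G) (x, ζ) :=
      (itd_smooth _ _ hG).differentiable (by simp) _
    have h0 : HasFDerivAt (fun y : Fin n → ℝ => (y, ζ))
        (ContinuousLinearMap.inl ℝ (Fin n → ℝ) (Fin n → ℝ)) x := hasFDerivAt_prodMk_left x ζ
    have := HasFDerivAt.comp (f := fun y : Fin n → ℝ => (y, ζ)) x hd.hasFDerivAt h0
    have h2 := this.fderiv
    simp only [Function.comp_def] at h2
    rw [h2]
    rfl

lemma pdm2_eq {n : ℕ} (α β : Fin n → ℕ) (g : (Fin n → ℝ) → (Fin n → ℝ) → F)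
    (hg : ContDiff ℝ (⊤ : ℕ∞) (fun q : (Fin n → ℝ) × (Fin n → ℝ) => g q.1 q.2))
    (x ζ : Fin n → ℝ) :
    pdm2 α β g x ζ = itd (e2 n) ((lidx α).map Sum.inl ++ (lidx β).map Sum.inr)
      (fun q : (Fin n → ℝ) × (Fin n → ℝ) => g q.1 q.2) (x, ζ) := by
  unfold pdm2
  simp only [pdm_eq]
  have h1 : ∀ x', itd (e1 n) (lidx β) (g x') = _ := fun x' => itd_inr hg (lidx β) x'
  simp only [h1]
  rw [itd_inl (itd_smooth _ _ hg), itd_append]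

lemma norm_e2 {n : ℕ} (i : Fin n ⊕ Fin n) : ‖e2 n i‖ ≤ 1 := by
  rcases i with i | i <;> simp [e2, Prod.norm_def, Pi.norm_single]

lemma perm_idx {n : ℕ} (l : List (Fin n)) : ∃ ν : Fin n → ℕ, l.Perm (lidx ν) :=
  ⟨fun i => l.count i, List.perm_iff_count.2 fun i => by rw [count_lidx]⟩

lemma perm_idx2 {n : ℕ} (l : List (Fin n ⊕ Fin n)) :
    ∃ α β : Fin n → ℕ, l.Perm ((lidx α).map Sum.inl ++ (lidx β).map Sum.inr) := by
  let _ : BEq (Fin n ⊕ Fin n) := instBEqOfDecidableEq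
  refine ⟨fun i => l.count (Sum.inl i), fun i => l.count (Sum.inr i),
    List.perm_iff_count.2 fun i => ?_⟩
  rcases i with i | i
  · rw [List.count_append, List.count_map_of_injective _ _ Sum.inl_injective, count_lidx]
    simp [List.count_eq_zero]
  · rw [List.count_append, List.count_map_of_injective _ _ Sum.inr_injective, count_lidx]
    simp [List.count_eq_zero]

lemma iter_of_pdm {n : ℕ} {f : (Fin n → ℝ) → F} (hf : ContDiff ℝ (⊤ : ℕ∞) f) (k : ℕ)
    (B : (Fin n → ℝ) → ℝ) (hB : ∀ q, 0 ≤ B q)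
    (h : ∀ ν : Fin n → ℕ, msize ν = k → ∃ C > 0, ∀ v, ‖pdm ν f v‖ ≤ C * B v) :
    ∃ C > 0, ∀ v, ‖iteratedFDeriv ℝ k f v‖ ≤ C * B v := by
  refine iter_bound (e1 n) (fun i w => w i) (fun w => ?_) (fun i w => norm_le_pi_norm w i) hf k B hB
    fun l hl => ?_
  · funext j; simp [e1, Finset.sum_apply, Pi.single_apply]
  · obtain ⟨ν, hν⟩ := perm_idx l
    obtain ⟨C, hC, hb⟩ := h ν (by rw [← length_lidx, ← hν.length_eq, hl])
    refine ⟨C, hC, fun q => ?_⟩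
    rw [itd_perm _ hν hf, ← pdm_eq]; exact hb q

lemma iter_of_pdm2 {n : ℕ} {g : (Fin n → ℝ) → (Fin n → ℝ) → F}
    (hg : ContDiff ℝ (⊤ : ℕ∞) (fun q : (Fin n → ℝ) × (Fin n → ℝ) => g q.1 q.2)) (k : ℕ)
    (B : (Fin n → ℝ) → (Fin n → ℝ) → ℝ) (hB : ∀ x ζ, 0 ≤ B x ζ)
    (h : ∀ α β : Fin n → ℕ, msize α + msize β = k →
      ∃ C > 0, ∀ x ζ, ‖pdm2 α β g x ζ‖ ≤ C * B x ζ) :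
    ∃ C > 0, ∀ x ζ, ‖iteratedFDeriv ℝ k
      (fun q : (Fin n → ℝ) × (Fin n → ℝ) => g q.1 q.2) (x, ζ)‖ ≤ C * B x ζ := by
  have := iter_bound (e2 n) (fun i w => Sum.elim w.1 w.2 i) (fun w => ?_) (fun i w => ?_) hg k
    (fun q => B q.1 q.2) (fun q => hB _ _) fun l hl => ?_
  · obtain ⟨C, hC, hb⟩ := this
    exact ⟨C, hC, fun x ζ => hb (x, ζ)⟩
  · rw [Fintype.sum_sum_type]
    ext j <;> simp [e2, Prod.fst_sum, Prod.snd_sum, Finset.sum_apply, Pi.single_apply]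
  · rcases i with i | i
    · exact (norm_le_pi_norm w.1 i).trans (norm_fst_le w)
    · exact (norm_le_pi_norm w.2 i).trans (norm_snd_le w)
  · obtain ⟨α, β, hν⟩ := perm_idx2 l
    obtain ⟨C, hC, hb⟩ := h α β (by
      rw [← hl, hν.length_eq]; simp [length_lidx])
    refine ⟨C, hC, fun q => ?_⟩
    rw [itd_perm _ hν hg, ← pdm2_eq _ _ _ hg]; exact hb q.1 q.2

lemma pdm2_le_iter {n : ℕ} {g : (Fin n → ℝ) → (Fin n → ℝ) → F}
    (hg : ContDiff ℝ (⊤ : ℕ∞) (fun q : (Fin n → ℝ) × (Fin n → ℝ) => g q.1 q.2))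
    (α β : Fin n → ℕ) (x ζ : Fin n → ℝ) :
    ‖pdm2 α β g x ζ‖ ≤ ‖iteratedFDeriv ℝ (msize α + msize β)
      (fun q : (Fin n → ℝ) × (Fin n → ℝ) => g q.1 q.2) (x, ζ)‖ := by
  rw [pdm2_eq _ _ _ hg]
  refine (norm_itd_le _ norm_e2 hg _ _).trans_eq ?_
  have : ((lidx α).map Sum.inl ++ (lidx β).map Sum.inr : List (Fin n ⊕ Fin n)).length
      = msize α + msize β := by simp [length_lidx]
  rw [this]

lemma one_le_jb {n : ℕ} (v : Fin n → ℝ) : 1 ≤ jb v := by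
  rw [jb, Real.one_le_sqrt]
  have : 0 ≤ ∑ i, (v i) ^ 2 := Finset.sum_nonneg fun i _ => sq_nonneg _
  linarith

lemma jb_pos {n : ℕ} (v : Fin n → ℝ) : 0 < jb v := zero_lt_one.trans_le (one_le_jb v)

lemma norm_le_jb {n : ℕ} (v : Fin n → ℝ) : ‖v‖ ≤ jb v := by
  refine (pi_norm_le_iff_of_nonneg (jb_pos v).le).2 fun i => ?_
  refine Real.abs_le_sqrt ?_
  have := Finset.single_le_sum (f := fun i => (v i) ^ 2) (fun i _ => sq_nonneg _) (Finset.mem_univ i)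
  linarith

lemma msize_eq_zero {n : ℕ} (ν : Fin n → ℕ) : msize ν = 0 ↔ ν = 0 := by
  simp [msize, Finset.sum_eq_zero_iff, funext_iff]

lemma G_iter {n : ℕ} {σ : ℝ} {f : (Fin n → ℝ) → F} (hf : GsigmaCl σ f) (k : ℕ) :
    ∃ C > 0, ∀ v, ‖iteratedFDeriv ℝ k (fderiv ℝ f) v‖ ≤ C * jb v ^ (-(σ * (k : ℝ))) := by
  simp only [norm_iteratedFDeriv_fderiv]
  refine iter_of_pdm hf.1 (k + 1) (fun v => jb v ^ (-(σ * (k : ℝ))))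
    (fun v => Real.rpow_nonneg (jb_pos v).le _) fun ν hν => ?_
  obtain ⟨C, hC, h⟩ := hf.2 ν (by rintro rfl; simp [msize] at hν)
  refine ⟨C, hC, fun v => ?_⟩
  have := h v
  rw [hν] at this
  simpa using this

lemma H_iter {n : ℕ} {σ κ w : ℝ} {g : (Fin n → ℝ) → (Fin n → ℝ) → F} (hg : Hsp σ κ w g) (k : ℕ) :
    ∃ C > 0, ∀ x ζ, ‖iteratedFDeriv ℝ (k + 1)
      (fun q : (Fin n → ℝ) × (Fin n → ℝ) => g q.1 q.2) (x, ζ)‖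
        ≤ C * (jb x ^ (-(σ * (k : ℝ))) * jb ζ ^ (w + κ * (k : ℝ))) := by
  refine iter_of_pdm2 hg.1 (k + 1) (fun x ζ => jb x ^ (-(σ * (k : ℝ))) * jb ζ ^ (w + κ * (k : ℝ)))
    (fun x ζ => mul_nonneg (Real.rpow_nonneg (jb_pos _).le _) (Real.rpow_nonneg (jb_pos _).le _))
    fun α β hν => ?_
  obtain ⟨C, hC, h⟩ := hg.2 α β (by rintro ⟨rfl, rfl⟩; simp [msize] at hν)
  refine ⟨C, hC, fun x ζ => ?_⟩
  have := h x ζ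
  rw [hν] at this
  simpa [mul_assoc] using this

lemma E_iter {n : ℕ} {σ κ w : ℝ} {g : (Fin n → ℝ) → (Fin n → ℝ) → F} (hg : Esp σ κ w g) (k : ℕ) :
    ∃ C > 0, ∀ x ζ, ‖iteratedFDeriv ℝ k
      (fun q : (Fin n → ℝ) × (Fin n → ℝ) => g q.1 q.2) (x, ζ)‖
        ≤ C * (jb x ^ (-(σ * (k : ℝ))) * jb ζ ^ (w + κ * (k : ℝ))) := by
  refine iter_of_pdm2 hg.1 k (fun x ζ => jb x ^ (-(σ * (k : ℝ))) * jb ζ ^ (w + κ * (k : ℝ)))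
    (fun x ζ => mul_nonneg (Real.rpow_nonneg (jb_pos _).le _) (Real.rpow_nonneg (jb_pos _).le _))
    fun α β hν => ?_
  obtain ⟨C, hC, h⟩ := hg.2 α β
  refine ⟨C, hC, fun x ζ => ?_⟩
  have := h x ζ
  rw [hν] at this
  simpa [mul_assoc] using this

lemma H_of_iter {n : ℕ} {σ κ w : ℝ} {g : (Fin n → ℝ) → (Fin n → ℝ) → F}
    (hg : ContDiff ℝ (⊤ : ℕ∞) (fun q : (Fin n → ℝ) × (Fin n → ℝ) => g q.1 q.2))
    (h : ∀ k : ℕ, ∃ C > 0, ∀ x ζ, ‖iteratedFDeriv ℝ (k + 1)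
      (fun q : (Fin n → ℝ) × (Fin n → ℝ) => g q.1 q.2) (x, ζ)‖
        ≤ C * (jb x ^ (-(σ * (k : ℝ))) * jb ζ ^ (w + κ * (k : ℝ)))) : Hsp σ κ w g := by
  refine ⟨hg, fun α β hν => ?_⟩
  obtain ⟨k, hk⟩ : ∃ k, msize α + msize β = k + 1 := by
    refine Nat.exists_eq_succ_of_ne_zero fun h0 => hν ?_
    rw [← msize_eq_zero, ← msize_eq_zero]; omega
  obtain ⟨C, hC, h⟩ := h k
  refine ⟨C, hC, fun x ζ => (pdm2_le_iter hg α β x ζ).trans ?_⟩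
  have := h x ζ
  rw [hk]
  simpa [mul_assoc] using this

lemma E_of_iter {n : ℕ} {σ κ w : ℝ} {g : (Fin n → ℝ) → (Fin n → ℝ) → F}
    (hg : ContDiff ℝ (⊤ : ℕ∞) (fun q : (Fin n → ℝ) × (Fin n → ℝ) => g q.1 q.2))
    (h : ∀ k : ℕ, ∃ C > 0, ∀ x ζ, ‖iteratedFDeriv ℝ k
      (fun q : (Fin n → ℝ) × (Fin n → ℝ) => g q.1 q.2) (x, ζ)‖
        ≤ C * (jb x ^ (-(σ * (k : ℝ))) * jb ζ ^ (w + κ * (k : ℝ)))) : Esp σ κ w g := by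
  refine ⟨hg, fun α β => ?_⟩
  obtain ⟨C, hC, h⟩ := h (msize α + msize β)
  refine ⟨C, hC, fun x ζ => (pdm2_le_iter hg α β x ζ).trans ?_⟩
  have := h x ζ
  rwa [← mul_assoc] at this

/-- Scaled Faa di Bruno bound at a point. -/
lemma scaled_comp {V X : Type*} [NormedAddCommGroup V] [NormedSpace ℝ V]
    [NormedAddCommGroup X] [NormedSpace ℝ X] {f : X → F} {G : V → X}
    (hf : ContDiff ℝ (⊤ : ℕ∞) f) (hG : ContDiff ℝ (⊤ : ℕ∞) G) (k : ℕ) (q : V) {C D s : ℝ}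
    (hs : 0 < s) (hC : ∀ i ≤ k, ‖iteratedFDeriv ℝ i f (G q)‖ * s ^ i ≤ C)
    (hD : ∀ i, 1 ≤ i → i ≤ k → s⁻¹ * ‖iteratedFDeriv ℝ i G q‖ ≤ D ^ i) :
    ‖iteratedFDeriv ℝ k (fun q => f (G q)) q‖ ≤ k.factorial * C * D ^ k := by
  have e : (fun q => f (G q)) = (fun z => f (s • z)) ∘ (fun q => s⁻¹ • G q) := by
    funext q
    simp [smul_smul, hs.ne']
  have hle : ∀ i : ℕ, ((i : ℕ) : WithTop ℕ∞) ≤ ((⊤ : ℕ∞) : WithTop ℕ∞) := fun i =>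
    WithTop.coe_le_coe.2 (le_top (a := (i : ℕ∞)))
  rw [e]
  refine norm_iteratedFDeriv_comp_le (N := ((⊤ : ℕ∞) : WithTop ℕ∞))
    (g := fun z => f (s • z)) (hf.comp (contDiff_const_smul s)) (hG.const_smul s⁻¹) (hle k) q
    (fun i hi => ?_) (fun i hi hik => ?_)
  · rw [iteratedFDeriv_comp_const_smul s (hf.of_le (hle i))]
    simp only [norm_smul, smul_smul, mul_inv_cancel₀ hs.ne', one_smul, norm_pow,
      Real.norm_of_nonneg hs.le]
    rw [mul_comm]; exact hC i hi
  · rw [iteratedFDeriv_const_smul_apply' ((hG.of_le (hle i)).contDiffAt), norm_smul,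
      Real.norm_of_nonneg (inv_nonneg.2 hs.le)]
    exact hD i hi hik

lemma df_iter {n : ℕ} {σ κ w : ℝ} (hσ : 0 ≤ σ) (hκ : 0 ≤ κ)
    {f : (Fin n → ℝ) → F} {g : (Fin n → ℝ) → (Fin n → ℝ) → (Fin n → ℝ)}
    (hf : GsigmaCl σ f) (hg : Hsp σ κ w g) {c r : ℝ} (hc : 0 < c) (hr : 0 ≤ r)
    (hlow : σ ≠ 0 → ∀ x ζ, c * jb x * jb ζ ^ (-r) ≤ jb (g x ζ)) (k : ℕ) :
    ∃ C > 0, ∀ x ζ, ‖iteratedFDeriv ℝ k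
      (fun q : (Fin n → ℝ) × (Fin n → ℝ) => fderiv ℝ f (g q.1 q.2)) (x, ζ)‖
        ≤ C * (jb x ^ (-(σ * (k : ℝ))) * jb ζ ^ ((max (r * σ) κ + |w|) * (k : ℝ))) := by
  set M := max (r * σ) κ + |w| with hM
  choose C hC hCb using G_iter hf
  choose K hK hKb using H_iter hg
  set C0 := ∑ i ∈ Finset.range (k + 1), C i
  set K0 := ∑ i ∈ Finset.range (k + 1), K i
  have hCi : ∀ i ≤ k, C i ≤ C0 := fun i hi =>
    Finset.single_le_sum (f := C) (fun j _ => (hC j).le) (Finset.mem_range.2 (by omega))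
  have hKi : ∀ i ≤ k, K i ≤ K0 := fun i hi =>
    Finset.single_le_sum (f := K) (fun j _ => (hK j).le) (Finset.mem_range.2 (by omega))
  have hC0 : 0 < C0 := (hC 0).trans_le (hCi 0 (by omega))
  have hK0 : 0 < K0 := (hK 0).trans_le (hKi 0 (by omega))
  have hcs : 0 < c ^ (-σ) := Real.rpow_pos_of_pos hc _
  set K' := max 1 (c ^ (-σ) * K0)
  have hK' : 1 ≤ K' := le_max_left _ _
  refine ⟨k.factorial * C0 * K' ^ k, by positivity, fun x ζ => ?_⟩
  have hX := jb_pos x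
  have hZ := jb_pos ζ
  have hZ1 := one_le_jb ζ
  have hY := jb_pos (g x ζ)
  have hdf : ContDiff ℝ (⊤ : ℕ∞) (fderiv ℝ f) := hf.1.fderiv_right (by simp)
  have hsinv : (jb (g x ζ) ^ σ)⁻¹ ≤ c ^ (-σ) * (jb x ^ (-σ) * jb ζ ^ (r * σ)) := by
    rw [← Real.rpow_neg hY.le]
    by_cases h0 : σ = 0
    · simp [h0]
    · have h1 := hlow h0 x ζ
      have h2 : 0 < c * jb x * jb ζ ^ (-r) := by positivity
      have h3 := Real.rpow_le_rpow_of_nonpos h2 h1 (neg_nonpos.2 hσ)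
      refine h3.trans_eq ?_
      rw [Real.mul_rpow (by positivity) (by positivity), Real.mul_rpow hc.le hX.le,
        ← Real.rpow_mul hZ.le, mul_assoc]
      congr 3
      ring
  have main := scaled_comp (f := fderiv ℝ f)
    (G := fun q : (Fin n → ℝ) × (Fin n → ℝ) => g q.1 q.2) hdf hg.1 k (x, ζ)
    (C := C0) (D := K' * (jb x ^ (-σ) * jb ζ ^ M)) (s := jb (g x ζ) ^ σ) (by positivity)
    (fun i hi => ?_) (fun i hi hik => ?_)
  · refine main.trans_eq ?_
    rw [mul_pow, mul_pow, ← Real.rpow_mul_natCast hX.le, ← Real.rpow_mul_natCast hZ.le]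
    rw [neg_mul]
    ring
  · have := hCb i (g x ζ)
    rw [← Real.rpow_mul_natCast hY.le]
    calc _ ≤ (C i * jb (g x ζ) ^ (-(σ * (i : ℝ)))) * jb (g x ζ) ^ (σ * (i : ℝ)) := by
          gcongr
      _ = C i := by
          rw [mul_assoc, ← Real.rpow_add hY]; simp
      _ ≤ C0 := hCi i hi
  · obtain ⟨j, rfl⟩ : ∃ j, i = j + 1 := ⟨i - 1, by omega⟩
    have h1 := hKb j x ζ
    have hexp : r * σ + (w + κ * (j : ℝ)) ≤ M * ((j + 1 : ℕ) : ℝ) := by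
      have e1 : r * σ ≤ max (r * σ) κ := le_max_left _ _
      have e2 : κ ≤ max (r * σ) κ := le_max_right _ _
      have e3 : w ≤ |w| := le_abs_self w
      have e4 : 0 ≤ |w| * (j : ℝ) := by positivity
      have e5 : κ * (j : ℝ) ≤ max (r * σ) κ * j := by gcongr
      rw [hM]; push_cast; nlinarith
    calc _ ≤ (c ^ (-σ) * (jb x ^ (-σ) * jb ζ ^ (r * σ))) *
            (K0 * (jb x ^ (-(σ * (j : ℝ))) * jb ζ ^ (w + κ * (j : ℝ)))) := by
          refine mul_le_mul hsinv (h1.trans ?_) (norm_nonneg _) (by positivity)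
          exact mul_le_mul_of_nonneg_right (hKi j (by omega)) (by positivity)
      _ = (c ^ (-σ) * K0) * (jb x ^ (-σ + -(σ * (j : ℝ))) *
            jb ζ ^ (r * σ + (w + κ * (j : ℝ)))) := by
          rw [Real.rpow_add hX, Real.rpow_add hZ (r * σ)]; ring
      _ ≤ K' ^ (j + 1) * (jb x ^ (-σ + -(σ * (j : ℝ))) * jb ζ ^ (M * ((j + 1 : ℕ) : ℝ))) := by
          refine mul_le_mul ((le_max_right _ _).trans (le_self_pow₀ hK' (by omega))) ?_
            (by positivity) (by positivity)
          exact mul_le_mul_of_nonneg_left (Real.rpow_le_rpow_of_exponent_le hZ1 hexp)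
            (by positivity)
      _ = _ := by
          rw [mul_pow, mul_pow, ← Real.rpow_mul_natCast hX.le, ← Real.rpow_mul_natCast hZ.le]
          congr 3
          push_cast; ring

lemma top_le (i : ℕ) : ((i : ℕ) : WithTop ℕ∞) ≤ ((⊤ : ℕ∞) : WithTop ℕ∞) :=
  WithTop.coe_le_coe.2 (le_top (a := (i : ℕ∞)))

lemma bilin_iter {D E₁ E₂ G : Type*} [NormedAddCommGroup D] [NormedSpace ℝ D]
    [NormedAddCommGroup E₁] [NormedSpace ℝ E₁] [NormedAddCommGroup E₂] [NormedSpace ℝ E₂]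
    [NormedAddCommGroup G] [NormedSpace ℝ G] (B : E₁ →L[ℝ] E₂ →L[ℝ] G) {f : D → E₁} {g : D → E₂}
    (hf : ContDiff ℝ (⊤ : ℕ∞) f) (hg : ContDiff ℝ (⊤ : ℕ∞) g) :
    ∃ b : ℝ, 0 ≤ b ∧ ∀ (n : ℕ) (x : D), ‖iteratedFDeriv ℝ n (fun y => B (f y) (g y)) x‖ ≤
      b * ∑ i ∈ Finset.range (n + 1),
        (n.choose i : ℝ) * ‖iteratedFDeriv ℝ i f x‖ * ‖iteratedFDeriv ℝ (n - i) g x‖ :=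
  ⟨‖B‖, B.opNorm_nonneg, fun n x => B.norm_iteratedFDeriv_le_of_bilinear hf hg x (top_le n)⟩

lemma comp_H {n : ℕ} {σ κ w : ℝ} (hσ : 0 ≤ σ) (hκ : 0 ≤ κ)
    {f : (Fin n → ℝ) → F} {g : (Fin n → ℝ) → (Fin n → ℝ) → (Fin n → ℝ)}
    (hf : GsigmaCl σ f) (hg : Hsp σ κ w g) {c r : ℝ} (hc : 0 < c) (hr : 0 ≤ r)
    (hlow : σ ≠ 0 → ∀ x ζ, c * jb x * jb ζ ^ (-r) ≤ jb (g x ζ)) :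
    Hsp σ (max (r * σ) κ + |w|) |w| (fun x ζ => f (g x ζ)) := by
  set M := max (r * σ) κ + |w| with hM
  refine H_of_iter (hf.1.comp hg.1) fun k => ?_
  choose C hC hCb using df_iter hσ hκ hf hg hc hr hlow
  choose K hK hKb using H_iter hg
  set G := fun q : (Fin n → ℝ) × (Fin n → ℝ) => g q.1 q.2 with hGdef
  have hdf : ContDiff ℝ (⊤ : ℕ∞) (fderiv ℝ f) := hf.1.fderiv_right (by simp)
  have hdfG : ContDiff ℝ (⊤ : ℕ∞) (fun q => fderiv ℝ f (G q)) := hdf.comp hg.1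
  have hdG : ContDiff ℝ (⊤ : ℕ∞) (fderiv ℝ G) := hg.1.fderiv_right (by simp)
  set B := ContinuousLinearMap.compL ℝ ((Fin n → ℝ) × (Fin n → ℝ)) (Fin n → ℝ) F
  have hfd : fderiv ℝ (fun q : (Fin n → ℝ) × (Fin n → ℝ) => f (g q.1 q.2))
      = fun q => B (fderiv ℝ f (G q)) (fderiv ℝ G q) := by
    funext q
    exact fderiv_comp q (hf.1.differentiable (by simp) _) (hg.1.differentiable (by simp) _)
  obtain ⟨b, hb0, hbb⟩ := bilin_iter B hdfG hdG
  refine ⟨b * ∑ i ∈ Finset.range (k + 1), (k.choose i : ℝ) * C i * K (k - i) + 1, ?_,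
    fun x ζ => ?_⟩
  · have : 0 ≤ ∑ i ∈ Finset.range (k + 1), (k.choose i : ℝ) * C i * K (k - i) :=
      Finset.sum_nonneg fun i _ => mul_nonneg (mul_nonneg (by positivity) (hC i).le) (hK _).le
    positivity
  have hX := jb_pos x
  have hZ := jb_pos ζ
  have hZ1 := one_le_jb ζ
  rw [← norm_iteratedFDeriv_fderiv, hfd]
  refine (hbb k (x, ζ)).trans ?_
  set T := jb x ^ (-(σ * (k : ℝ))) * jb ζ ^ (|w| + M * (k : ℝ)) with hT
  have hTp : 0 < T := by positivity
  have : ∑ i ∈ Finset.range (k + 1), (k.choose i : ℝ) *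
      ‖iteratedFDeriv ℝ i (fun q => fderiv ℝ f (G q)) (x, ζ)‖ *
      ‖iteratedFDeriv ℝ (k - i) (fderiv ℝ G) (x, ζ)‖ ≤
      (∑ i ∈ Finset.range (k + 1), (k.choose i : ℝ) * C i * K (k - i)) * T := by
    rw [Finset.sum_mul]
    refine Finset.sum_le_sum fun i hi => ?_
    have hik : i ≤ k := by have := Finset.mem_range.1 hi; omega
    obtain ⟨j, rfl⟩ := Nat.exists_eq_add_of_le hik
    rw [Nat.add_sub_cancel_left, norm_iteratedFDeriv_fderiv, mul_assoc, mul_assoc, mul_assoc]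
    refine mul_le_mul_of_nonneg_left ?_ (by positivity)
    have hexp : M * (i : ℝ) + (w + κ * (j : ℝ)) ≤ |w| + M * ((i + j : ℕ) : ℝ) := by
      have e2 : κ ≤ M := (le_max_right _ _).trans (le_add_of_nonneg_right (abs_nonneg _))
      have e3 : w ≤ |w| := le_abs_self w
      have e5 : κ * (j : ℝ) ≤ M * j := by gcongr
      push_cast; linarith
    have hCp := hC i
    have hKp := hK j
    calc _ ≤ (C i * (jb x ^ (-(σ * (i : ℝ))) * jb ζ ^ (M * (i : ℝ)))) *
          (K j * (jb x ^ (-(σ * (j : ℝ))) * jb ζ ^ (w + κ * (j : ℝ)))) :=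
          mul_le_mul (hCb i x ζ) (hKb j x ζ) (norm_nonneg _) (by positivity)
      _ = C i * (K j * (jb x ^ (-(σ * (i : ℝ)) + -(σ * (j : ℝ))) *
            jb ζ ^ (M * (i : ℝ) + (w + κ * (j : ℝ))))) := by
          rw [Real.rpow_add hX, Real.rpow_add hZ (M * (i : ℝ))]; ring
      _ = C i * (K j * (jb x ^ (-(σ * ((i + j : ℕ) : ℝ))) *
            jb ζ ^ (M * (i : ℝ) + (w + κ * (j : ℝ))))) := by
          congr 4; push_cast; ring
      _ ≤ _ := by
          rw [hT]
          gcongr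
  calc _ ≤ b * ((∑ i ∈ Finset.range (k + 1), (k.choose i : ℝ) * C i * K (k - i)) * T) :=
        mul_le_mul_of_nonneg_left this hb0
    _ ≤ _ := by nlinarith

lemma snd_iter {n : ℕ} (j : ℕ) (x ζ : Fin n → ℝ) :
    ‖iteratedFDeriv ℝ j (fun q : (Fin n → ℝ) × (Fin n → ℝ) => q.2) (x, ζ)‖ ≤
      if j = 0 then jb ζ else if j = 1 then 1 else 0 := by
  rcases j with _ | _ | j
  · simpa using norm_le_jb ζ
  · rw [← norm_iteratedFDeriv_fderiv]
    simpa [fderiv_snd] using ContinuousLinearMap.norm_snd_le (𝕜 := ℝ) (E := Fin n → ℝ) (F := Fin n → ℝ)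
  · rw [← norm_iteratedFDeriv_fderiv]
    have : fderiv ℝ (fun q : (Fin n → ℝ) × (Fin n → ℝ) => q.2)
        = fun _ => ContinuousLinearMap.snd ℝ _ _ := by funext q; exact fderiv_snd
    rw [this, iteratedFDeriv_const_of_ne (by omega)]
    simp

lemma mulVec_H {n : ℕ} {σ κ w : ℝ} (hσ : 0 ≤ σ) (hκ : 0 ≤ κ)
    {P : (Fin n → ℝ) → (Fin n → ℝ) → Matrix (Fin n) (Fin n) ℝ} (hP : Esp σ κ w P) :
    Hsp σ κ (w + κ + 1) (fun x ζ => Matrix.mulVec (P x ζ) ζ) := by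
  let B0 : Matrix (Fin n) (Fin n) ℝ →ₗ[ℝ] (Fin n → ℝ) →ₗ[ℝ] (Fin n → ℝ) :=
    Matrix.mulVecBilin ℝ ℝ
  let B : Matrix (Fin n) (Fin n) ℝ →L[ℝ] (Fin n → ℝ) →L[ℝ] (Fin n → ℝ) :=
    LinearMap.toContinuousLinearMap
      ((LinearMap.toContinuousLinearMap (𝕜 := ℝ) (E := Fin n → ℝ) (F' := Fin n → ℝ)).toLinearMap
        ∘ₗ B0)
  have hB : ∀ A v, B A v = Matrix.mulVec A v := fun A v => rfl
  have hs : ContDiff ℝ (⊤ : ℕ∞) (fun q : (Fin n → ℝ) × (Fin n → ℝ) => q.2) := contDiff_snd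
  have hfun : (fun q : (Fin n → ℝ) × (Fin n → ℝ) => Matrix.mulVec (P q.1 q.2) q.2)
      = fun q => B (P q.1 q.2) q.2 := rfl
  refine H_of_iter ?_ fun k => ?_
  · rw [hfun]
    exact (B.contDiff.comp hP.1).clm_apply hs
  rw [hfun]
  choose C hC hCb using E_iter hP
  obtain ⟨b, hb0, hbb⟩ := bilin_iter B hP.1 hs
  refine ⟨b * ∑ i ∈ Finset.range (k + 1 + 1), ((k + 1).choose i : ℝ) * C i + 1, ?_,
    fun x ζ => ?_⟩
  · have : 0 ≤ ∑ i ∈ Finset.range (k + 1 + 1), ((k + 1).choose i : ℝ) * C i :=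
      Finset.sum_nonneg fun i _ => mul_nonneg (by positivity) (hC i).le
    positivity
  have hX := jb_pos x
  have hX1 := one_le_jb x
  have hZ := jb_pos ζ
  have hZ1 := one_le_jb ζ
  refine (hbb (k + 1) (x, ζ)).trans ?_
  set T := jb x ^ (-(σ * (k : ℝ))) * jb ζ ^ (w + κ + 1 + κ * (k : ℝ)) with hT
  have hTp : 0 < T := by positivity
  have : ∑ i ∈ Finset.range (k + 1 + 1), ((k + 1).choose i : ℝ) *
      ‖iteratedFDeriv ℝ i (fun q : (Fin n → ℝ) × (Fin n → ℝ) => P q.1 q.2) (x, ζ)‖ *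
      ‖iteratedFDeriv ℝ (k + 1 - i) (fun q : (Fin n → ℝ) × (Fin n → ℝ) => q.2) (x, ζ)‖ ≤
      (∑ i ∈ Finset.range (k + 1 + 1), ((k + 1).choose i : ℝ) * C i) * T := by
    rw [Finset.sum_mul]
    refine Finset.sum_le_sum fun i hi => ?_
    have hik : i ≤ k + 1 := by have := Finset.mem_range.1 hi; omega
    have hCp := hC i
    rw [mul_assoc, mul_assoc]
    refine mul_le_mul_of_nonneg_left ?_ (by positivity)
    have h2 := snd_iter (k + 1 - i) x ζ
    have h1 := hCb i x ζ
    refine (mul_le_mul h1 h2 (norm_nonneg _) (by positivity)).trans ?_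
    rw [mul_assoc]
    refine mul_le_mul_of_nonneg_left ?_ hCp.le
    rcases (by omega : i = k + 1 ∨ i = k ∨ i < k) with rfl | rfl | hlt
    · simp only [Nat.sub_self, if_true]
      rw [mul_assoc]
      refine mul_le_mul (Real.rpow_le_rpow_of_exponent_le hX1 (by push_cast; linarith)) ?_
        (by positivity) (by positivity)
      rw [← Real.rpow_add_one hZ.ne']
      exact Real.rpow_le_rpow_of_exponent_le hZ1 (by push_cast; linarith)
    · simp only [Nat.add_sub_cancel_left, if_true, one_ne_zero, if_false, mul_one]
      refine mul_le_mul_of_nonneg_left ?_ (by positivity)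
      exact Real.rpow_le_rpow_of_exponent_le hZ1 (by linarith)
    · rw [if_neg (by omega), if_neg (by omega), mul_zero]
      exact hTp.le
  calc _ ≤ b * ((∑ i ∈ Finset.range (k + 1 + 1), ((k + 1).choose i : ℝ) * C i) * T) :=
        mul_le_mul_of_nonneg_left this hb0
    _ ≤ _ := by nlinarith

end Helpers

/-- (a) If `P ∈ E_{σ,κ}^w(M_n(ℝ))` then `(x,ζ) ↦ P_{x,ζ}(ζ)` is in
`H_{σ,κ}^{w+κ+1}(ℝ^n)`.  (b) If `f ∈ G_σ(ℝ^n, E)` and `g ∈ H_{σ,κ}^{w}(ℝ^n)` with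
`⟨g⟩ ≥ c⟨x⟩⟨ζ⟩^{-r}` (when `σ ≠ 0`), then `f ∘ g ∈ H_{σ, max{rσ,κ}+|w|}^{|w|}(E)`;
moreover for vector-valued `f ∈ G_σ(ℝ^n, ℝ^p)`, `(x,ζ) ↦ (df)_{g(x,ζ)}` is in
`E_{σ, max{rσ,κ}+|w|}^{0}(M_{p,n}(ℝ))`. -/
theorem statement12 {n p : ℕ} {E : Type*} [NormedAddCommGroup E] [NormedSpace ℝ E]
    [FiniteDimensional ℝ E]
    (σ κ w : ℝ) (hσ : σ ∈ Set.Icc (0 : ℝ) 1) (hκ : 0 ≤ κ)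
    (P : (Fin n → ℝ) → (Fin n → ℝ) → Matrix (Fin n) (Fin n) ℝ)
    (f : (Fin n → ℝ) → E) (fp : (Fin n → ℝ) → (Fin p → ℝ))
    (g : (Fin n → ℝ) → (Fin n → ℝ) → (Fin n → ℝ))
    (hg : Hsp σ κ w g)
    (c r : ℝ) (hc : 0 < c) (hr : 0 ≤ r)
    (hlow : σ ≠ 0 → ∀ x ζ, c * jb x * jb ζ ^ (-r) ≤ jb (g x ζ)) :
    (Esp σ κ w P → Hsp σ κ (w + κ + 1) (fun x ζ => Matrix.mulVec (P x ζ) ζ)) ∧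
    (GsigmaCl σ f → Hsp σ (max (r * σ) κ + |w|) |w| (fun x ζ => f (g x ζ))) ∧
    (GsigmaCl σ fp → Esp σ (max (r * σ) κ + |w|) 0 (fun x ζ => fderiv ℝ fp (g x ζ))) := by
  refine ⟨fun hP => mulVec_H hσ.1 hκ hP, fun hf => comp_H hσ.1 hκ hf hg hc hr hlow,
    fun hf => E_of_iter ?_ fun k => ?_⟩
  · have hdf : ContDiff ℝ (⊤ : ℕ∞) (fderiv ℝ fp) := hf.1.fderiv_right (by simp)
    exact hdf.comp hg.1
  · simpa using df_iter hσ.1 hκ hf hg hc hr hlow k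
end
end
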